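/- arXiv:math/0703084 — 7 statements merged into one kernel-verified Lean document; each statement's English description precedes it below -/
import Mathlib

section
/- Let q ≥ 1, let a_1,…,a_q, b_1,…,b_q be real with b_k > a_k > 0 for all k, let σ ∈ ℝ and x > −1. Then F(σ;(a_q);(b_q);−x) = A_0 · ∫_0^1 s^{a_1−1} g((a_q);(b_q);s) (1+sx)^{−σ} ds, where A_0 = ∏_{k=1}^q Γ(b_k)/(Γ(a_k)Γ(b_k−a_k)), and g((a_q);(b_q);s) = ∫_{Λ_q(s)} [1 − s/(t_2⋯t_q)]^{b_1−a_1−1} ∏_{k=2}^q t_k^{a_k−a_1−1}(1−t_k)^{b_k−a_k−1} dt_2⋯dt_q with Λ_q(s) = {(t_2,…,t_q) ∈ (0,1)^{q−1} : t_2⋯t_q > s} (for q = 1 one sets g ≡ 1). -/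
open MeasureTheory Real Filter

/-- Generalized hypergeometric function `F(σ;(a_q);(b_q);−x)` (with `q = n+1` upper/lower
parameter pairs), defined via the multiple Euler integral. -/
noncomputable def hypF {n : ℕ} (σ : ℝ) (a b : Fin (n + 1) → ℝ) (x : ℝ) : ℝ :=
  (∏ k, Gamma (b k) / (Gamma (a k) * Gamma (b k - a k))) *
    ∫ t : Fin (n + 1) → ℝ in Set.univ.pi fun _ => Set.Icc (0 : ℝ) 1,
      (∏ k, t k ^ (a k - 1) * (1 - t k) ^ (b k - a k - 1)) * (1 + (∏ k, t k) * x) ^ (-σ)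

/-- The function `g((a_q);(b_q);s)` of Lemma 1: an integral over
`Λ_q(s) = {(t_2,…,t_q) ∈ (0,1)^{q-1} : t_2⋯t_q > s}` (here `q = n+1`, so the integration
variable runs over `Fin n → ℝ`). -/
noncomputable def hypg {n : ℕ} (a b : Fin (n + 1) → ℝ) (s : ℝ) : ℝ :=
  ∫ t : Fin n → ℝ in
      {t : Fin n → ℝ | (∀ i, t i ∈ Set.Ioo (0 : ℝ) 1) ∧ s < ∏ i, t i},
    (1 - s / ∏ i, t i) ^ (b 0 - a 0 - 1) *
      ∏ i, t i ^ (a i.succ - a 0 - 1) * (1 - t i) ^ (b i.succ - a i.succ - 1)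

lemma aux_beta {p r : ℝ} (hp : 0 < p) (hr : 0 < r) :
    Integrable (fun x : ℝ => x ^ (p - 1) * (1 - x) ^ (r - 1))
      (volume.restrict (Set.Ioo (0 : ℝ) 1)) := by
  have h := Complex.betaIntegral_convergent (u := p) (v := r) (by simpa) (by simpa)
  rw [intervalIntegrable_iff_integrableOn_Ioo_of_le zero_le_one] at h
  have h2 := h.re
  refine h2.congr ?_
  filter_upwards [ae_restrict_mem measurableSet_Ioo] with t ht
  have h1 : (0 : ℝ) ≤ 1 - t := by linarith [ht.2]
  have e1 : ((t : ℂ) ^ ((p : ℂ) - 1)) = ((t ^ (p - 1) : ℝ) : ℂ) := by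
    rw [Complex.ofReal_cpow ht.1.le]; push_cast; rfl
  have e2 : ((1 - (t : ℂ)) ^ ((r : ℂ) - 1)) = (((1 - t) ^ (r - 1) : ℝ) : ℂ) := by
    rw [Complex.ofReal_cpow h1]; push_cast; rfl
  rw [e1, e2, ← Complex.ofReal_mul]
  simp

lemma aux_swap {T : Type*} [MeasurableSpace T] (μ : Measure T) [SFinite μ] (P : T → ℝ)
    (hP : Measurable P) (hpos : ∀ᵐ t ∂μ, 0 < P t) (G : ℝ × T → ℝ) (hGm : Measurable G)
    (hG : Integrable G ((volume : Measure ℝ).prod μ)) :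
    ∫ z, G z ∂((volume : Measure ℝ).prod μ) = ∫ s : ℝ, ∫ t, G (s / P t, t) / P t ∂μ := by
  have hm : Measurable (fun z : ℝ × T => G (z.1 / P z.2, z.2) / P z.2) := by fun_prop
  have hH : Integrable (fun z : ℝ × T => G (z.1 / P z.2, z.2) / P z.2)
      ((volume : Measure ℝ).prod μ) := by
    rw [integrable_prod_iff' hm.aestronglyMeasurable]
    rw [integrable_prod_iff' hGm.aestronglyMeasurable] at hG
    constructor
    · filter_upwards [hpos, hG.1] with t ht h
      exact (h.comp_div ht.ne').div_const _
    · refine hG.2.congr ?_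
      filter_upwards [hpos] with t ht
      simp only [norm_div]
      rw [integral_div, Measure.integral_comp_div (fun u => ‖G (u, t)‖) (P t)]
      rw [Real.norm_eq_abs, smul_eq_mul, mul_div_cancel_left₀ _ (abs_pos.2 ht.ne').ne']
  rw [integral_prod_symm _ hG, integral_integral_swap (f := fun s t => G (s / P t, t) / P t) hH]
  refine integral_congr_ae ?_
  filter_upwards [hpos] with t ht
  rw [integral_div, Measure.integral_comp_div (fun u => G (u, t)) (P t)]
  rw [smul_eq_mul, abs_of_pos ht, mul_div_cancel_left₀ _ ht.ne']

lemma aux_bdd (σ x : ℝ) (hx : -1 < x) :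
    ∃ C : ℝ, ∀ s ∈ Set.Icc (0 : ℝ) 1, ‖(1 + s * x) ^ (-σ)‖ ≤ C := by
  refine isCompact_Icc.exists_bound_of_continuousOn ?_
  refine ContinuousOn.rpow_const (by fun_prop) ?_
  intro s hs
  left
  have : 0 < 1 + s * x := by
    rcases hs.1.eq_or_lt with h | h
    · rw [← h]; norm_num
    · nlinarith [hs.2, mul_pos h (by linarith : 0 < 1 + x)]
  exact this.ne'

/-- Generalized Stieltjes representation:
`F(σ;(a_q);(b_q);−x) = A₀ ∫₀¹ s^{a₁−1} g((a_q);(b_q);s) (1+sx)^{−σ} ds`. -/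
theorem genStieltjes_repr {n : ℕ} (σ x : ℝ) (a b : Fin (n + 1) → ℝ)
    (hab : ∀ k, 0 < a k ∧ a k < b k) (hx : -1 < x) :
    hypF σ a b x =
      (∏ k, Gamma (b k) / (Gamma (a k) * Gamma (b k - a k))) *
        ∫ s in Set.Ioo (0 : ℝ) 1, s ^ (a 0 - 1) * hypg a b s * (1 + s * x) ^ (-σ) := by
  unfold hypF
  congr 1
  set m : Measure ℝ := volume.restrict (Set.Ioo (0 : ℝ) 1) with hmdef
  set μ : Measure (Fin n → ℝ) := Measure.pi (fun _ : Fin n => m) with hμ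
  set Φ : (Fin (n + 1) → ℝ) → ℝ := fun t =>
    (∏ k, t k ^ (a k - 1) * (1 - t k) ^ (b k - a k - 1)) * (1 + (∏ k, t k) * x) ^ (-σ) with hΦ
  set K : ℝ × (Fin n → ℝ) → ℝ := fun z =>
    ((z.1 ^ (a 0 - 1) * (1 - z.1) ^ (b 0 - a 0 - 1)) *
      (∏ i, z.2 i ^ (a i.succ - 1) * (1 - z.2 i) ^ (b i.succ - a i.succ - 1))) *
      (1 + (z.1 * ∏ i, z.2 i) * x) ^ (-σ) with hK
  have hμr : μ = volume.restrict (Set.univ.pi fun _ => Set.Ioo (0 : ℝ) 1) := by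
    rw [hμ, hmdef, volume_pi, Measure.restrict_pi_pi]
  have hr : (volume : Measure (Fin (n + 1) → ℝ)).restrict
      (Set.univ.pi fun _ => Set.Icc (0 : ℝ) 1) = Measure.pi (fun _ => m) := by
    rw [hmdef, ← Measure.restrict_pi_pi, ← volume_pi]
    refine Measure.restrict_congr_set ?_
    have := Measure.univ_pi_Ioo_ae_eq_Icc (μ := fun _ : Fin (n + 1) => (volume : Measure ℝ))
      (f := fun _ => (0 : ℝ)) (g := fun _ => (1 : ℝ))
    rw [← Set.pi_univ_Icc] at this
    exact this.symm
  have hmemN : ∀ᵐ t ∂(Measure.pi fun _ : Fin (n + 1) => m), ∀ i, t i ∈ Set.Ioo (0 : ℝ) 1 := by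
    rw [hmdef, ← Measure.restrict_pi_pi]
    filter_upwards [ae_restrict_mem (MeasurableSet.univ_pi fun _ => measurableSet_Ioo)] with t ht
    exact fun i => ht i (Set.mem_univ i)
  have hmemn : ∀ᵐ t ∂μ, ∀ i, t i ∈ Set.Ioo (0 : ℝ) 1 := by
    rw [hμr]
    filter_upwards [ae_restrict_mem (MeasurableSet.univ_pi fun _ => measurableSet_Ioo)] with t ht
    exact fun i => ht i (Set.mem_univ i)
  obtain ⟨C, hC⟩ := aux_bdd σ x hx
  have hΦint : Integrable Φ (Measure.pi fun _ => m) := by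
    refine Integrable.mul_bdd (c := C) (Integrable.fintype_prod (f := fun k (u : ℝ) =>
      u ^ (a k - 1) * (1 - u) ^ (b k - a k - 1)) fun k => aux_beta (hab k).1 (by linarith [(hab k).2])) ?_ ?_
    · exact Measurable.aestronglyMeasurable (by fun_prop)
    · filter_upwards [hmemN] with t ht
      exact hC _ ⟨Finset.prod_nonneg fun i _ => (ht i).1.le,
        Finset.prod_le_one (fun i _ => (ht i).1.le) fun i _ => (ht i).2.le⟩
  have hmp := measurePreserving_piFinSuccAbove (fun _ : Fin (n + 1) => m) 0
  have hKΦ : ∀ t, Φ t = K (MeasurableEquiv.piFinSuccAbove (fun _ => ℝ) 0 t) := by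
    intro t
    simp only [hΦ, hK, Fin.prod_univ_succ]
    rfl
  have hKint : Integrable K (m.prod μ) := by
    rw [← hmp.integrable_comp_emb (MeasurableEquiv.measurableEmbedding _)]
    exact hΦint.congr (Eventually.of_forall hKΦ)
  have hKm : Measurable K := by fun_prop
  set S : Set (ℝ × (Fin n → ℝ)) := Set.Ioo (0 : ℝ) 1 ×ˢ Set.univ with hS
  have hSm : MeasurableSet S := measurableSet_Ioo.prod MeasurableSet.univ
  have hmprod : m.prod μ = ((volume : Measure ℝ).prod μ).restrict S := by
    rw [hS, ← Measure.prod_restrict, Measure.restrict_univ]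
  have hpos : ∀ᵐ t ∂μ, 0 < ∏ i, t i := by
    filter_upwards [hmemn] with t ht
    exact Finset.prod_pos fun i _ => (ht i).1
  rw [hr, ← integral_indicator measurableSet_Ioo]
  calc ∫ t, Φ t ∂(Measure.pi fun _ => m)
      = ∫ z, K z ∂(m.prod μ) := by
        rw [← hmp.integral_comp (MeasurableEquiv.measurableEmbedding _)]
        exact integral_congr_ae (Eventually.of_forall hKΦ)
    _ = ∫ z, S.indicator K z ∂((volume : Measure ℝ).prod μ) := by
        rw [integral_indicator hSm, hmprod]
    _ = ∫ s : ℝ, ∫ t, S.indicator K (s / (∏ i, t i), t) / (∏ i, t i) ∂μ := by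
        refine aux_swap μ (fun t => ∏ i, t i) (by fun_prop) hpos _ (hKm.indicator hSm) ?_
        rw [integrable_indicator_iff hSm, IntegrableOn, ← hmprod]
        exact hKint
    _ = _ := by
        congr 1
        funext s
        by_cases hs : s ∈ Set.Ioo (0 : ℝ) 1
        · rw [Set.indicator_of_mem hs, hypg]
          have hset : {t : Fin n → ℝ | (∀ i, t i ∈ Set.Ioo (0 : ℝ) 1) ∧ s < ∏ i, t i} =
              {t | s < ∏ i, t i} ∩ (Set.univ.pi fun _ => Set.Ioo (0 : ℝ) 1) := by
            ext t; simp [and_comm]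
          have hm1 : MeasurableSet {t : Fin n → ℝ | s < ∏ i, t i} :=
            measurableSet_lt (by fun_prop) (by fun_prop)
          rw [hset, ← Measure.restrict_restrict hm1, ← hμr, ← integral_indicator hm1,
            ← integral_const_mul, ← integral_mul_const]
          refine integral_congr_ae ?_
          filter_upwards [hmemn, hpos] with t ht hP
          by_cases hsP : s < ∏ i, t i
          · have h1 : (s / (∏ i, t i), t) ∈ S :=
              ⟨⟨div_pos hs.1 hP, (div_lt_one hP).2 hsP⟩, trivial⟩
            have h2 : t ∈ {t : Fin n → ℝ | s < ∏ i, t i} := hsP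
            rw [Set.indicator_of_mem h1, Set.indicator_of_mem h2]
            simp only [hK]
            rw [div_mul_cancel₀ _ hP.ne', div_rpow hs.1.le hP.le]
            have h3 : (∏ i, t i ^ (a i.succ - 1) * (1 - t i) ^ (b i.succ - a i.succ - 1)) =
                (∏ i, t i) ^ (a 0) *
                (∏ i, t i ^ (a i.succ - a 0 - 1) * (1 - t i) ^ (b i.succ - a i.succ - 1)) := by
              rw [← Real.finsetProd_rpow _ _ (fun i _ => (ht i).1.le), ← Finset.prod_mul_distrib]
              refine Finset.prod_congr rfl fun i _ => ?_
              rw [← mul_assoc, ← rpow_add (ht i).1]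
              ring_nf
            rw [h3, rpow_sub_one hP.ne']
            have h4 : (∏ i, t i) ^ (a 0) ≠ 0 := (rpow_pos_of_pos hP _).ne'
            have h5 := hP.ne'
            field_simp
          · have h1 : (s / (∏ i, t i), t) ∉ S := fun h =>
              hsP ((div_lt_one hP).1 h.1.2)
            have h2 : t ∉ {t : Fin n → ℝ | s < ∏ i, t i} := hsP
            rw [Set.indicator_of_notMem h1, Set.indicator_of_notMem h2]
            simp
        · rw [Set.indicator_of_notMem hs]
          refine integral_eq_zero_of_ae ?_
          filter_upwards [hmemn, hpos] with t ht hP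
          have h1 : (s / (∏ i, t i), t) ∉ S := fun h => by
            refine hs ⟨(div_pos_iff_of_pos_right hP).1 h.1.1, ?_⟩
            exact ((div_lt_one hP).1 h.1.2).trans_le
              (Finset.prod_le_one (fun i _ => (ht i).1.le) fun i _ => (ht i).2.le)
          rw [Set.indicator_of_notMem h1]
          simp
end

section
/- Let q ≥ 1, δ > 0 and b_k > a_k > 0 for k = 1,…,q. The function x ↦ f(σ,(a_q);(b_q);δ;x) := F(σ;(a_q)+δ;(b_q)+δ;−x) / F(σ;(a_q);(b_q);−x), where (a_q)+δ means each a_k is replaced by a_k+δ, is strictly monotone decreasing on (−1,∞) if σ > 0 and strictly monotone increasing on (−1,∞) if σ < 0. -/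
open MeasureTheory Real Filter

lemma cheb {α : Type*} [MeasurableSpace α] {μ : Measure α} {U V p : α → ℝ} {h : ℝ → ℝ} {δ : ℝ}
    (hδ : 0 < δ) (hU : ∀ᵐ t ∂μ, 0 < U t) (hp : ∀ᵐ t ∂μ, 0 < p t ∧ p t < 1)
    (hVU : ∀ᵐ t ∂μ, V t = U t * h (p t)) (hh : StrictAntiOn h (Set.Icc 0 1))
    (iU : Integrable U μ) (iV : Integrable V μ)
    (iUp : Integrable (fun t => U t * p t ^ δ) μ) (iVp : Integrable (fun t => V t * p t ^ δ) μ)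
    (hne : ∀ c : ℝ, ¬ (∀ᵐ t ∂μ, p t = c)) (hIU : 0 < ∫ t, U t ∂μ) :
    (∫ t, V t * p t ^ δ ∂μ) * (∫ t, U t ∂μ) < (∫ t, U t * p t ^ δ ∂μ) * (∫ t, V t ∂μ) := by
  set A := ∫ t, U t ∂μ with hA
  set B := ∫ t, U t * p t ^ δ ∂μ with hB
  have hB0 : 0 ≤ B := by
    apply integral_nonneg_of_ae
    filter_upwards [hU, hp] with t h1 h2
    exact mul_nonneg h1.le (rpow_nonneg h2.1.le _)
  have hBA : B ≤ A := by
    apply integral_mono_ae iUp iU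
    filter_upwards [hU, hp] with t h1 h2
    exact mul_le_of_le_one_right h1.le (rpow_le_one h2.1.le h2.2.le hδ.le)
  set m := B / A with hm
  have hm0 : 0 ≤ m := by positivity
  have hm1 : m ≤ 1 := (div_le_one hIU).2 hBA
  set c := m ^ (1 / δ) with hc
  have hc0 : 0 ≤ c := rpow_nonneg hm0 _
  have hc1 : c ≤ 1 := rpow_le_one hm0 hm1 (by positivity)
  have hcm : c ^ δ = m := by
    rw [hc, ← rpow_mul hm0, one_div_mul_cancel hδ.ne', rpow_one]
  have key : ∀ t, 0 < U t → (0 < p t ∧ p t < 1) → V t = U t * h (p t) → p t ≠ c →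
      0 < (m - p t ^ δ) * (V t - h c * U t) := by
    intro t h1 h2 h3 h4
    have e : (m - p t ^ δ) * (V t - h c * U t) = U t * ((m - p t ^ δ) * (h (p t) - h c)) := by
      rw [h3]; ring
    rw [e]
    apply mul_pos h1
    rw [← hcm]
    rcases lt_or_gt_of_ne h4 with h5 | h5
    · exact mul_pos (sub_pos.2 (rpow_lt_rpow h2.1.le h5 hδ))
        (sub_pos.2 (hh ⟨h2.1.le, h2.2.le⟩ ⟨hc0, hc1⟩ h5))
    · exact mul_pos_of_neg_of_neg (sub_neg.2 (rpow_lt_rpow hc0 h5 hδ))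
        (sub_neg.2 (hh ⟨hc0, hc1⟩ ⟨h2.1.le, h2.2.le⟩ h5))
  have eG : (fun t => (m - p t ^ δ) * (V t - h c * U t)) =
      fun t => (m * V t - V t * p t ^ δ) - (h c * m * U t - h c * (U t * p t ^ δ)) := by
    funext t; ring
  have iG : Integrable (fun t => (m - p t ^ δ) * (V t - h c * U t)) μ := by
    rw [eG]
    exact ((iV.const_mul _).sub iVp).sub ((iU.const_mul _).sub (iUp.const_mul _))
  have nG : 0 ≤ᵐ[μ] fun t => (m - p t ^ δ) * (V t - h c * U t) := by
    filter_upwards [hU, hp, hVU] with t h1 h2 h3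
    by_cases h4 : p t = c
    · simp [h4, hcm]
    · exact (key t h1 h2 h3 h4).le
  have pG : 0 < ∫ t, (m - p t ^ δ) * (V t - h c * U t) ∂μ := by
    apply lt_of_le_of_ne (integral_nonneg_of_ae nG)
    intro h0
    have := (integral_eq_zero_iff_of_nonneg_ae nG iG).1 h0.symm
    apply hne c
    filter_upwards [this, hU, hp, hVU] with t h0 h1 h2 h3
    by_contra h4
    exact (key t h1 h2 h3 h4).ne' h0
  have i1 : Integrable (fun t => m * V t - V t * p t ^ δ) μ := (iV.const_mul _).sub iVp
  have i2 : Integrable (fun t => h c * m * U t - h c * (U t * p t ^ δ)) μ :=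
    (iU.const_mul _).sub (iUp.const_mul _)
  rw [eG, integral_sub i1 i2,
    integral_sub (iV.const_mul _) iVp, integral_sub (iU.const_mul _) (iUp.const_mul _),
    integral_const_mul, integral_const_mul, integral_const_mul, ← hA, ← hB] at pG
  have hmA : m * A = B := by rw [hm]; field_simp
  have : h c * m * A - h c * B = 0 := by rw [← hmA]; ring
  rw [this, sub_zero, sub_pos] at pG
  calc _ < m * (∫ t, V t ∂μ) * A := mul_lt_mul_of_pos_right pG hIU
    _ = _ := by rw [← hmA]; ring

lemma beta_int {u v : ℝ} (hu : 0 < u) (hv : 0 < v) :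
    Integrable (fun x : ℝ => x ^ (u - 1) * (1 - x) ^ (v - 1))
      (volume.restrict (Set.Ioo (0 : ℝ) 1)) := by
  have h := Complex.betaIntegral_convergent (u := u) (v := v) (by simpa) (by simpa)
  rw [intervalIntegrable_iff_integrableOn_Ioo_of_le zero_le_one] at h
  have h2 := h.re
  refine h2.congr ?_
  filter_upwards [ae_restrict_mem measurableSet_Ioo] with x hx
  have e : ((x : ℂ) ^ ((u : ℂ) - 1) * (1 - (x : ℂ)) ^ ((v : ℂ) - 1))
      = ((x ^ (u - 1) * (1 - x) ^ (v - 1) : ℝ) : ℂ) := by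
    push_cast
    rw [Complex.ofReal_cpow hx.1.le, Complex.ofReal_cpow (sub_nonneg.2 hx.2.le)]
    push_cast
    rfl
  rw [e]
  simp

/-- Lebesgue measure on the open cube. -/
noncomputable def cubeM (n : ℕ) : Measure (Fin (n + 1) → ℝ) :=
  volume.restrict (Set.univ.pi fun _ => Set.Ioo (0 : ℝ) 1)

lemma cubeM_ae (n : ℕ) : ∀ᵐ t ∂(cubeM n), ∀ k, 0 < t k ∧ t k < 1 := by
  filter_upwards [ae_restrict_mem (MeasurableSet.univ_pi fun _ => measurableSet_Ioo)] with t ht k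
  exact ht k trivial

lemma restrict_cube (n : ℕ) :
    (volume.restrict (Set.univ.pi fun _ => Set.Icc (0 : ℝ) 1) : Measure (Fin (n + 1) → ℝ))
      = cubeM n := by
  rw [cubeM]
  apply Measure.restrict_congr_set
  have h := Measure.univ_pi_Ioo_ae_eq_Icc (μ := fun _ : Fin (n + 1) => (volume : Measure ℝ))
    (f := fun _ => 0) (g := fun _ => 1)
  rw [← Set.pi_univ_Icc] at h
  exact h.symm

lemma w_int {n : ℕ} (a b : Fin (n + 1) → ℝ) (hab : ∀ k, 0 < a k ∧ a k < b k) :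
    Integrable (fun t : Fin (n + 1) → ℝ =>
      ∏ k, t k ^ (a k - 1) * (1 - t k) ^ (b k - a k - 1)) (cubeM n) := by
  rw [cubeM, volume_pi, Measure.restrict_pi_pi]
  exact Integrable.fintype_prod (f := fun k (x : ℝ) => x ^ (a k - 1) * (1 - x) ^ (b k - a k - 1))
    fun k => beta_int (hab k).1 (sub_pos.2 (hab k).2)

lemma cube_prod_mem {n : ℕ} {t : Fin (n + 1) → ℝ} (ht : ∀ k, 0 < t k ∧ t k < 1) :
    0 < (∏ k, t k) ∧ (∏ k, t k) < 1 := by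
  refine ⟨Finset.prod_pos fun k _ => (ht k).1, ?_⟩
  calc ∏ k, t k < ∏ k : Fin (n + 1), (1 : ℝ) :=
        Finset.prod_lt_prod_of_nonempty (fun k _ => (ht k).1) (fun k _ => (ht k).2)
          Finset.univ_nonempty
    _ = 1 := by simp

lemma base_pos {p x : ℝ} (hp : 0 ≤ p) (hp1 : p ≤ 1) (hx : -1 < x) : 0 < 1 + p * x := by
  rcases le_or_gt 0 x with h | h
  · positivity
  · nlinarith

/-- multiply an integrable function by a bounded continuous function of the product -/
lemma mul_int {n : ℕ} {f : (Fin (n + 1) → ℝ) → ℝ} (hf : Integrable f (cubeM n)) {g : ℝ → ℝ}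
    (hg : ContinuousOn g (Set.Icc 0 1)) :
    Integrable (fun t => f t * g (∏ k, t k)) (cubeM n) := by
  obtain ⟨C, hC⟩ := isCompact_Icc.exists_bound_of_continuousOn hg
  apply hf.mul_bdd (c := C)
  · apply ContinuousOn.aestronglyMeasurable _ (MeasurableSet.univ_pi fun _ => measurableSet_Ioo)
    refine hg.comp (by fun_prop) fun t ht => ?_
    have := cube_prod_mem (t := t) fun k => ht k trivial
    exact ⟨this.1.le, this.2.le⟩
  · filter_upwards [cubeM_ae n] with t ht
    have := cube_prod_mem ht
    exact hC _ ⟨this.1.le, this.2.le⟩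

lemma not_const (n : ℕ) (c : ℝ) : ¬ (∀ᵐ t ∂(cubeM n), (∏ k, t k) = c) := by
  intro h
  have h1 := Measure.eqOn_open_of_ae_eq (f := fun t : Fin (n + 1) → ℝ => ∏ k, t k)
    (g := fun _ => c) h (isOpen_set_pi Set.finite_univ fun _ _ => isOpen_Ioo)
    (by fun_prop) (by fun_prop)
  have h2 := h1 (x := fun _ => 1 / 2) (fun k _ => by norm_num)
  have h3 := h1 (x := fun _ => 1 / 3) (fun k _ => by norm_num)
  simp only [Finset.prod_const, Finset.card_univ, Fintype.card_fin] at h2 h3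
  have : (1 / 3 : ℝ) ^ (n + 1) < (1 / 2) ^ (n + 1) :=
    pow_lt_pow_left₀ (by norm_num) (by norm_num) (by omega)
  linarith

lemma cont_phi {x σ : ℝ} (hx : -1 < x) :
    ContinuousOn (fun p : ℝ => (1 + p * x) ^ (-σ)) (Set.Icc 0 1) := by
  refine ContinuousOn.rpow_const (by fun_prop) fun p hp => Or.inl ?_
  exact (base_pos hp.1 hp.2 hx).ne'

lemma const_pos {n : ℕ} (a b : Fin (n + 1) → ℝ) (hab : ∀ k, 0 < a k ∧ a k < b k) :
    0 < ∏ k, Gamma (b k) / (Gamma (a k) * Gamma (b k - a k)) :=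
  Finset.prod_pos fun k _ => div_pos (Gamma_pos_of_pos ((hab k).1.trans (hab k).2))
    (mul_pos (Gamma_pos_of_pos (hab k).1) (Gamma_pos_of_pos (sub_pos.2 (hab k).2)))

lemma hyp_shift {n : ℕ} (σ δ x : ℝ) (a b : Fin (n + 1) → ℝ) :
    hypF σ (fun k => a k + δ) (fun k => b k + δ) x =
      (∏ k, Gamma (b k + δ) / (Gamma (a k + δ) * Gamma ((b k + δ) - (a k + δ)))) *
      ∫ t, ((∏ k, t k ^ (a k - 1) * (1 - t k) ^ (b k - a k - 1)) * (1 + (∏ k, t k) * x) ^ (-σ))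
        * (∏ k, t k) ^ δ ∂(cubeM n) := by
  rw [hypF, restrict_cube]
  congr 1
  apply integral_congr_ae
  filter_upwards [cubeM_ae n] with t ht
  rw [← finsetProd_rpow _ _ (fun k _ => (ht k).1.le), mul_right_comm, ← Finset.prod_mul_distrib]
  congr 1
  refine Finset.prod_congr rfl fun k _ => ?_
  rw [show a k + δ - 1 = (a k - 1) + δ by ring, rpow_add (ht k).1, add_sub_add_right_eq_sub]
  ring

lemma ratio_lt {n : ℕ} (σ δ : ℝ) (a b : Fin (n + 1) → ℝ) (hδ : 0 < δ)
    (hab : ∀ k, 0 < a k ∧ a k < b k) {x y : ℝ} (hx : -1 < x) (hy : -1 < y)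
    (hh : StrictAntiOn (fun p : ℝ => (1 + p * y) ^ (-σ) / (1 + p * x) ^ (-σ)) (Set.Icc 0 1)) :
    hypF σ (fun k => a k + δ) (fun k => b k + δ) y / hypF σ a b y <
      hypF σ (fun k => a k + δ) (fun k => b k + δ) x / hypF σ a b x := by
  have hw : ∀ᵐ t ∂(cubeM n), 0 < ∏ k, t k ^ (a k - 1) * (1 - t k) ^ (b k - a k - 1) := by
    filter_upwards [cubeM_ae n] with t ht
    exact Finset.prod_pos fun k _ => mul_pos (rpow_pos_of_pos (ht k).1 _)
      (rpow_pos_of_pos (sub_pos.2 (ht k).2) _)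
  have hP : ∀ᵐ t ∂(cubeM n), 0 < (∏ k, t k) ∧ (∏ k, t k) < 1 := by
    filter_upwards [cubeM_ae n] with t ht using cube_prod_mem ht
  have hpos : ∀ z : ℝ, -1 < z → ∀ᵐ t ∂(cubeM n),
      0 < (∏ k, t k ^ (a k - 1) * (1 - t k) ^ (b k - a k - 1)) * (1 + (∏ k, t k) * z) ^ (-σ) := by
    intro z hz
    filter_upwards [hw, hP] with t h1 h2
    exact mul_pos h1 (rpow_pos_of_pos (base_pos h2.1.le h2.2.le hz) _)
  have hi : ∀ z : ℝ, -1 < z → Integrable (fun t : Fin (n + 1) → ℝ =>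
      (∏ k, t k ^ (a k - 1) * (1 - t k) ^ (b k - a k - 1)) * (1 + (∏ k, t k) * z) ^ (-σ))
      (cubeM n) := fun z hz => mul_int (w_int a b hab) (cont_phi hz)
  have hc : ContinuousOn (fun p : ℝ => p ^ δ) (Set.Icc 0 1) :=
    (continuous_rpow_const hδ.le).continuousOn
  have hI : ∀ z : ℝ, -1 < z → 0 < ∫ t, (∏ k, t k ^ (a k - 1) * (1 - t k) ^ (b k - a k - 1)) *
      (1 + (∏ k, t k) * z) ^ (-σ) ∂(cubeM n) := by
    intro z hz
    have nn : 0 ≤ᵐ[cubeM n] fun t => (∏ k, t k ^ (a k - 1) * (1 - t k) ^ (b k - a k - 1)) *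
      (1 + (∏ k, t k) * z) ^ (-σ) := by
      filter_upwards [hpos z hz] with t ht using ht.le
    apply lt_of_le_of_ne (integral_nonneg_of_ae nn)
    intro h0
    have := (integral_eq_zero_iff_of_nonneg_ae nn (hi z hz)).1 h0.symm
    apply not_const n 0
    filter_upwards [this, hpos z hz] with t h1 h2
    exact absurd h1 h2.ne'
  have main := cheb (μ := cubeM n) (p := fun t => ∏ k, t k) hδ (hpos x hx) hP
    (V := fun t => (∏ k, t k ^ (a k - 1) * (1 - t k) ^ (b k - a k - 1)) *
      (1 + (∏ k, t k) * y) ^ (-σ))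
    (by
      filter_upwards [hP] with t h2
      have := rpow_pos_of_pos (base_pos h2.1.le h2.2.le hx) (-σ)
      field_simp) hh (hi x hx) (hi y hy) (mul_int (hi x hx) hc) (mul_int (hi y hy) hc)
    (not_const n) (hI x hx)
  rw [hyp_shift, hyp_shift, hypF, hypF, restrict_cube, mul_div_mul_comm, mul_div_mul_comm]
  apply mul_lt_mul_of_pos_left
  · rwa [div_lt_div_iff₀ (hI y hy) (hI x hx)]
  · exact div_pos (const_pos (fun k => a k + δ) (fun k => b k + δ) fun k =>
      ⟨add_pos (hab k).1 hδ, by linarith [(hab k).2]⟩) (const_pos a b hab)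

lemma quot_mono {x y : ℝ} (hx : -1 < x) (hy : -1 < y) (hxy : x < y) {p q : ℝ}
    (hp : p ∈ Set.Icc (0 : ℝ) 1) (hq : q ∈ Set.Icc (0 : ℝ) 1) (hpq : p < q) :
    (1 + p * y) / (1 + p * x) < (1 + q * y) / (1 + q * x) := by
  rw [div_lt_div_iff₀ (base_pos hp.1 hp.2 hx) (base_pos hq.1 hq.2 hx)]
  nlinarith [mul_pos (sub_pos.2 hxy) (sub_pos.2 hpq)]

/-- Theorem 1: the ratio `F(σ;(a_q)+δ;(b_q)+δ;−x) / F(σ;(a_q);(b_q);−x)` is strictly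
decreasing on `(−1,∞)` when `σ > 0` and strictly increasing when `σ < 0`. -/
theorem ratio_monotone {n : ℕ} (σ δ : ℝ) (a b : Fin (n + 1) → ℝ) (hδ : 0 < δ)
    (hab : ∀ k, 0 < a k ∧ a k < b k) :
    (0 < σ →
      StrictAntiOn
        (fun x => hypF σ (fun k => a k + δ) (fun k => b k + δ) x / hypF σ a b x)
        (Set.Ioi (-1 : ℝ))) ∧
    (σ < 0 →
      StrictMonoOn
        (fun x => hypF σ (fun k => a k + δ) (fun k => b k + δ) x / hypF σ a b x)
        (Set.Ioi (-1 : ℝ))) := by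
  constructor
  · intro hσ x hx y hy hxy
    refine ratio_lt σ δ a b hδ hab hx hy fun p hp q hq hpq => ?_
    have p1 := base_pos hp.1 hp.2 hx
    have p2 := base_pos hp.1 hp.2 hy
    have q1 := base_pos hq.1 hq.2 hx
    have q2 := base_pos hq.1 hq.2 hy
    simp only
    rw [← div_rpow p2.le p1.le, ← div_rpow q2.le q1.le]
    exact rpow_lt_rpow_of_neg (div_pos p2 p1) (quot_mono hx hy hxy hp hq hpq) (neg_neg_of_pos hσ)
  · intro hσ x hx y hy hxy
    refine ratio_lt σ δ a b hδ hab hy hx fun p hp q hq hpq => ?_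
    have p1 := base_pos hp.1 hp.2 hx
    have p2 := base_pos hp.1 hp.2 hy
    have q1 := base_pos hq.1 hq.2 hx
    have q2 := base_pos hq.1 hq.2 hy
    simp only
    rw [← div_rpow p1.le p2.le, ← div_rpow q1.le q2.le]
    refine rpow_lt_rpow (div_pos q1 q2).le ?_ (neg_pos.2 hσ)
    have := quot_mono hx hy hxy hp hq hpq
    rw [div_lt_div_iff₀ p1 q1] at this
    rw [div_lt_div_iff₀ q2 p2]
    linarith
end

section
/- Let q ≥ 1, δ > 0, b_k > a_k > 0 for k = 1,…,q, and 0 < σ < min(a_1,…,a_q). Then, as x → +∞, the ratio F(σ;(a_q)+δ;(b_q)+δ;−x)/F(σ;(a_q);(b_q);−x) tends to the limit ∏_{i=1}^q [Γ(a_i) Γ(a_i+δ−σ) Γ(b_i−σ) Γ(b_i+δ)] / [Γ(a_i−σ) Γ(a_i+δ) Γ(b_i) Γ(b_i+δ−σ)]. -/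
open MeasureTheory Real Filter

lemma beta_aux (u v : ℝ) (hu : 0 < u) (hv : 0 < v) :
    IntegrableOn (fun t : ℝ => t ^ (u - 1) * (1 - t) ^ (v - 1)) (Set.Ioo 0 1) ∧
    ∫ t in Set.Ioo (0:ℝ) 1, t ^ (u - 1) * (1 - t) ^ (v - 1)
      = Gamma u * Gamma v / Gamma (u + v) := by
  have h1 := Complex.betaIntegral_convergent (u := u) (v := v) (by simpa) (by simpa)
  rw [intervalIntegrable_iff_integrableOn_Ioo_of_le (by simp)] at h1
  have he : ∀ x ∈ Set.Ioo (0:ℝ) 1, (x : ℂ) ^ ((u:ℂ) - 1) * (1 - (x : ℂ)) ^ ((v:ℂ) - 1)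
      = ((x ^ (u - 1) * (1 - x) ^ (v - 1) : ℝ) : ℂ) := by
    intro x hx
    rw [Complex.ofReal_mul, Complex.ofReal_cpow hx.1.le,
      Complex.ofReal_cpow (by linarith [hx.2])]
    push_cast
    rfl
  have h2 := (integrableOn_congr_fun he measurableSet_Ioo).1 h1
  refine ⟨?_, ?_⟩
  · have := h2.re
    simpa [IntegrableOn] using this
  · have h3 := Complex.betaIntegral_eq_Gamma_mul_div (u := u) (v := v) (by simpa) (by simpa)
    rw [Complex.betaIntegral, intervalIntegral.integral_of_le (by norm_num),
      integral_Ioc_eq_integral_Ioo, setIntegral_congr_fun measurableSet_Ioo he,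
      integral_complex_ofReal] at h3
    simp_rw [← Complex.ofReal_add, Complex.Gamma_ofReal] at h3
    exact_mod_cast h3

lemma cube_measure (n : ℕ) : (volume : Measure (Fin (n+1) → ℝ)).restrict
    (Set.univ.pi fun _ => Set.Icc (0 : ℝ) 1) =
    Measure.pi (fun _ => (volume : Measure ℝ).restrict (Set.Ioo 0 1)) := by
  rw [volume_pi, Measure.restrict_pi_pi]
  simp_rw [restrict_Ioo_eq_restrict_Icc]

lemma cube_measure' (n : ℕ) : (volume : Measure (Fin (n+1) → ℝ)).restrict
    (Set.univ.pi fun _ => Set.Ioo (0 : ℝ) 1) =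
    Measure.pi (fun _ => (volume : Measure ℝ).restrict (Set.Ioo 0 1)) := by
  rw [volume_pi, Measure.restrict_pi_pi]

lemma key_bound {P x σ : ℝ} (hP : 0 < P) (hx : 0 < x) :
    x ^ σ * (1 + P * x) ^ (-σ) = ((1 + P * x) / x) ^ (-σ) := by
  have : 0 < P * x := mul_pos hP hx
  rw [div_rpow (by linarith) hx.le, rpow_neg hx.le σ, div_inv_eq_mul, mul_comm]

lemma key_lim {n : ℕ} (σ : ℝ) (a b : Fin (n + 1) → ℝ) 
    (hσ : 0 < σ) (hσa : ∀ k, σ < a k) (hab : ∀ k, 0 < a k ∧ a k < b k) :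
    Tendsto (fun x => x ^ σ * hypF σ a b x) atTop
      (nhds (∏ i, Gamma (b i) * Gamma (a i - σ) / (Gamma (a i) * Gamma (b i - σ)))) := by
  have hbeta := fun k => beta_aux (a k - σ) (b k - a k) (by linarith [hσa k])
    (by linarith [(hab k).2])
  have hae : ∀ᵐ t : Fin (n+1) → ℝ ∂(Measure.pi (fun _ => (volume : Measure ℝ).restrict
      (Set.Ioo 0 1))), ∀ k, 0 < t k ∧ t k < 1 := by
    rw [← cube_measure']
    filter_upwards [ae_restrict_mem (MeasurableSet.univ_pi fun _ => measurableSet_Ioo)] with t ht k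
    exact ht k (Set.mem_univ k)
  have hprod : ∀ t : Fin (n+1) → ℝ, (∀ k, 0 < t k ∧ t k < 1) →
      (∏ k, t k ^ (a k - σ - 1) * (1 - t k) ^ (b k - a k - 1)) =
      (∏ k, t k ^ (a k - 1) * (1 - t k) ^ (b k - a k - 1)) * (∏ k, t k) ^ (-σ) := by
    intro t ht
    rw [← Real.finsetProd_rpow _ _ (fun k _ => (ht k).1.le), ← Finset.prod_mul_distrib]
    refine Finset.prod_congr rfl fun k _ => ?_
    rw [show a k - σ - 1 = (a k - 1) + (-σ) by ring, rpow_add (ht k).1]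
    ring
  have hdom : Tendsto (fun x : ℝ => ∫ t : Fin (n + 1) → ℝ,
      (∏ k, t k ^ (a k - 1) * (1 - t k) ^ (b k - a k - 1)) *
        (x ^ σ * (1 + (∏ k, t k) * x) ^ (-σ))
      ∂(Measure.pi (fun _ => (volume : Measure ℝ).restrict (Set.Ioo 0 1)))) atTop
      (nhds (∫ t : Fin (n + 1) → ℝ, (∏ k, t k ^ (a k - σ - 1) * (1 - t k) ^ (b k - a k - 1))
      ∂(Measure.pi (fun _ => (volume : Measure ℝ).restrict (Set.Ioo 0 1))))) := by
    refine tendsto_integral_filter_of_dominated_convergence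
      (fun t => ∏ k, t k ^ (a k - σ - 1) * (1 - t k) ^ (b k - a k - 1)) ?_ ?_ ?_ ?_
    · refine Eventually.of_forall fun x => Measurable.aestronglyMeasurable ?_
      fun_prop
    · filter_upwards [eventually_gt_atTop 0] with x hx
      filter_upwards [hae] with t ht
      have hP : 0 < ∏ k, t k := Finset.prod_pos fun k _ => (ht k).1
      have hQ : 0 ≤ ∏ k, t k ^ (a k - 1) * (1 - t k) ^ (b k - a k - 1) :=
        Finset.prod_nonneg fun k _ => mul_nonneg (rpow_nonneg (ht k).1.le _)
          (rpow_nonneg (by linarith [(ht k).2]) _)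
      rw [hprod t ht, key_bound hP hx, norm_mul, norm_of_nonneg hQ,
        norm_of_nonneg (by positivity)]
      refine mul_le_mul_of_nonneg_left ?_ hQ
      refine rpow_le_rpow_of_nonpos hP ?_ (by linarith)
      rw [le_div_iff₀ hx]; linarith
    · exact Integrable.fintype_prod (fun k => (hbeta k).1)
    · filter_upwards [hae] with t ht
      have hP : 0 < ∏ k, t k := Finset.prod_pos fun k _ => (ht k).1
      rw [hprod t ht]
      refine Tendsto.const_mul _ ?_
      have h1 : Tendsto (fun x : ℝ => (x⁻¹ + ∏ k, t k) ^ (-σ)) atTop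
          (nhds ((0 + ∏ k, t k) ^ (-σ))) :=
        (tendsto_inv_atTop_zero.add_const _).rpow_const (Or.inl (by simpa using hP.ne'))
      rw [zero_add] at h1
      refine h1.congr' ?_
      filter_upwards [eventually_gt_atTop 0] with x hx
      rw [key_bound hP hx]
      congr 1
      field_simp
  rw [integral_fintype_prod_eq_prod
    (f := fun k s => s ^ (a k - σ - 1) * (1 - s) ^ (b k - a k - 1))] at hdom
  simp_rw [fun k => (hbeta k).2] at hdom
  have h2 := hdom.const_mul (∏ k, Gamma (b k) / (Gamma (a k) * Gamma (b k - a k)))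
  rw [← Finset.prod_mul_distrib] at h2
  convert h2 using 2
  · rename_i x
    rw [hypF, cube_measure, mul_left_comm, ← integral_const_mul]
    congr 2
    ext t
    ring
  · refine Finset.prod_congr rfl fun k _ => ?_
    have := (Gamma_pos_of_pos (sub_pos.2 (hab k).2)).ne'
    rw [show a k - σ + (b k - a k) = b k - σ by ring]
    field_simp

/-- The limit of the ratio `F(σ;(a_q)+δ;(b_q)+δ;−x)/F(σ;(a_q);(b_q);−x)` as `x → +∞`. -/
theorem ratio_tendsto_atTop {n : ℕ} (σ δ : ℝ) (a b : Fin (n + 1) → ℝ) (hδ : 0 < δ)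
    (hσ : 0 < σ) (hσa : ∀ k, σ < a k) (hab : ∀ k, 0 < a k ∧ a k < b k) :
    Tendsto (fun x => hypF σ (fun k => a k + δ) (fun k => b k + δ) x / hypF σ a b x) atTop
      (nhds (∏ i, Gamma (a i) * Gamma (a i + δ - σ) * Gamma (b i - σ) * Gamma (b i + δ) /
        (Gamma (a i - σ) * Gamma (a i + δ) * Gamma (b i) * Gamma (b i + δ - σ)))) := by
  have h1 := key_lim σ a b hσ hσa hab
  have h2 := key_lim σ (fun k => a k + δ) (fun k => b k + δ) hσ
    (fun k => by linarith [hσa k])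
    (fun k => ⟨by linarith [hab k], by linarith [(hab k).2]⟩)
  have hG : ∀ k, 0 < Gamma (b k) * Gamma (a k - σ) / (Gamma (a k) * Gamma (b k - σ)) := by
    intro k
    have := hσa k
    have := hab k
    exact div_pos (mul_pos (Gamma_pos_of_pos (by linarith)) (Gamma_pos_of_pos (by linarith)))
      (mul_pos (Gamma_pos_of_pos (by linarith)) (Gamma_pos_of_pos (by linarith)))
  have h3 := h2.div h1 (Finset.prod_pos fun k _ => hG k).ne'
  rw [← Finset.prod_div_distrib] at h3
  have h4 : ∀ k, Gamma (a k) * Gamma (a k + δ - σ) * Gamma (b k - σ) * Gamma (b k + δ) /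
        (Gamma (a k - σ) * Gamma (a k + δ) * Gamma (b k) * Gamma (b k + δ - σ)) =
      Gamma (b k + δ) * Gamma (a k + δ - σ) / (Gamma (a k + δ) * Gamma (b k + δ - σ)) /
      (Gamma (b k) * Gamma (a k - σ) / (Gamma (a k) * Gamma (b k - σ))) := by
    intro k
    rw [div_div_div_eq]
    congr 1 <;> ring
  simp_rw [h4]
  refine h3.congr' ?_
  filter_upwards [eventually_gt_atTop 0] with x hx
  simp only [Pi.div_apply]
  exact mul_div_mul_left _ _ (rpow_pos_of_pos hx σ).ne'
end

section
/- Let q ≥ 1 and b_k > a_k > 1 for k = 1,…,q. Then for every x > 0, 1/(1 + x ∏_{i=1}^q (a_i/b_i)) < F(1;(a_q);(b_q);−x) < 1/(1 + x ∏_{i=1}^q ((a_i−1)/(b_i−1))). -/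
open MeasureTheory Real Filter

open ProbabilityTheory in
lemma aux_beta1 (s c : ℝ) (hs : 0 < s) (hc : 0 < c) :
    ∫ t in Set.Ioo (0:ℝ) 1, t ^ (s - 1) * (1 - t) ^ (c - 1) = beta s c := by
  rw [beta_eq_betaIntegralReal s c hs hc,
      Complex.betaIntegral, intervalIntegral.integral_of_le (by norm_num),
      ← integral_Ioc_eq_integral_Ioo, ← RCLike.re_to_complex, ← integral_re]
  · refine setIntegral_congr_fun measurableSet_Ioc fun x hx ↦ ?_
    obtain ⟨hx1, hx2⟩ := hx
    norm_cast
    rw [← Complex.ofReal_cpow, ← Complex.ofReal_cpow, RCLike.re_to_complex,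
        Complex.re_mul_ofReal, Complex.ofReal_re]
    all_goals linarith
  · have := Complex.betaIntegral_convergent (u := s) (v := c) (by simpa) (by simpa)
    exact (intervalIntegrable_iff_integrableOn_Ioc_of_le (by norm_num)).1 this

lemma aux_beta1_int (s c : ℝ) (hs : 0 < s) (hc : 0 < c) :
    Integrable (fun t : ℝ => t ^ (s - 1) * (1 - t) ^ (c - 1))
      (volume.restrict (Set.Ioo (0:ℝ) 1)) := by
  by_contra h
  have h1 := aux_beta1 s c hs hc
  rw [integral_undef h] at h1
  exact (ProbabilityTheory.beta_pos hs hc).ne h1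

lemma aux_vol (m : ℕ) : (volume : Measure (Fin m → ℝ)).restrict
      (Set.univ.pi fun _ => Set.Ioo (0 : ℝ) 1)
    = Measure.pi fun _ => (volume : Measure ℝ).restrict (Set.Ioo (0 : ℝ) 1) := by
  rw [volume_pi, Measure.restrict_pi_pi]

lemma aux_betaN {m : ℕ} (s c : Fin m → ℝ) (hs : ∀ k, 0 < s k) (hc : ∀ k, 0 < c k) :
    IntegrableOn (fun t : Fin m → ℝ => ∏ k, t k ^ (s k - 1) * (1 - t k) ^ (c k - 1))
      (Set.univ.pi fun _ => Set.Ioo (0 : ℝ) 1) ∧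
    ∫ t : Fin m → ℝ in Set.univ.pi fun _ => Set.Ioo (0 : ℝ) 1,
      ∏ k, t k ^ (s k - 1) * (1 - t k) ^ (c k - 1)
      = ∏ k, ProbabilityTheory.beta (s k) (c k) := by
  unfold IntegrableOn
  rw [aux_vol]
  refine ⟨Integrable.fintype_prod (f := fun k t => t ^ (s k - 1) * (1 - t) ^ (c k - 1))
    fun k => aux_beta1_int _ _ (hs k) (hc k), ?_⟩
  rw [integral_fintype_prod_eq_prod (f := fun k t => t ^ (s k - 1) * (1 - t) ^ (c k - 1))]
  exact Finset.prod_congr rfl fun k _ => aux_beta1 _ _ (hs k) (hc k)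

lemma aux_beta_succ (s c : ℝ) (hs : 0 < s) (hc : 0 < c) :
    ProbabilityTheory.beta (s + 1) c = ProbabilityTheory.beta s c * (s / (s + c)) := by
  unfold ProbabilityTheory.beta
  rw [show s + 1 + c = (s + c) + 1 by ring, Real.Gamma_add_one hs.ne',
    Real.Gamma_add_one (by positivity)]
  have := (Real.Gamma_pos_of_pos (add_pos hs hc)).ne'
  field_simp

lemma aux_lt {n : ℕ} (f g : (Fin (n + 1) → ℝ) → ℝ) (M : ℝ) (hM : 0 < M)
    (hf : IntegrableOn f (Set.univ.pi fun _ => Set.Ioo (0 : ℝ) 1))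
    (hg : IntegrableOn g (Set.univ.pi fun _ => Set.Ioo (0 : ℝ) 1))
    (hle : ∀ t ∈ (Set.univ.pi fun _ => Set.Ioo (0 : ℝ) 1), f t ≤ g t)
    (hlt : ∀ t ∈ (Set.univ.pi fun _ => Set.Ioo (0 : ℝ) 1), (∏ k, t k) < M → f t < g t) :
    ∫ t in (Set.univ.pi fun _ => Set.Ioo (0 : ℝ) 1), f t
      < ∫ t in (Set.univ.pi fun _ => Set.Ioo (0 : ℝ) 1), g t := by
  have hopen : IsOpen (Set.univ.pi fun _ : Fin (n+1) => Set.Ioo (0 : ℝ) 1) :=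
    isOpen_set_pi Set.finite_univ fun _ _ => isOpen_Ioo
  have hms := hopen.measurableSet
  rw [← sub_pos, ← integral_sub hg hf]
  change 0 < ∫ t in (Set.univ.pi fun _ => Set.Ioo (0 : ℝ) 1), (g - f) t
  rw [setIntegral_pos_iff_support_of_nonneg_ae _ (hg.sub hf)]
  · have ho : IsOpen ((Set.univ.pi fun _ : Fin (n+1) => Set.Ioo (0 : ℝ) 1) ∩
        {t | (∏ k, t k) < M}) :=
      hopen.inter (isOpen_lt (by fun_prop) continuous_const)
    have hne : ((Set.univ.pi fun _ : Fin (n+1) => Set.Ioo (0 : ℝ) 1) ∩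
        {t | (∏ k, t k) < M}).Nonempty := by
      have h1 : 0 < min M 1 := lt_min hM one_pos
      have h2 := min_le_right M 1
      have h3 := min_le_left M 1
      refine ⟨fun _ => min M 1 / 2, fun _ _ => ⟨by positivity, by linarith⟩, ?_⟩
      simp only [Set.mem_setOf_eq, Finset.prod_const, Finset.card_univ, Fintype.card_fin]
      have := pow_le_of_le_one (a := min M 1 / 2) (by positivity) (by linarith)
        (n := n + 1) (by omega)
      linarith
    refine (ho.measure_pos volume hne).trans_le (measure_mono ?_)
    rintro t ⟨ht, htM⟩
    exact ⟨(sub_pos.2 (hlt t ht htM)).ne', ht⟩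
  · filter_upwards [ae_restrict_mem hms] with t ht
    exact sub_nonneg.2 (hle t ht)

/-- Theorem 2: two-sided bounds for `F(1;(a_q);(b_q);−x)` for `x > 0`. -/
theorem hypF_two_sided {n : ℕ} (a b : Fin (n + 1) → ℝ)
    (hab : ∀ k, 1 < a k ∧ a k < b k) (x : ℝ) (hx : 0 < x) :
    1 / (1 + x * ∏ i, a i / b i) < hypF 1 a b x ∧
      hypF 1 a b x < 1 / (1 + x * ∏ i, (a i - 1) / (b i - 1)) := by
  have ha0 : ∀ k, 0 < a k := fun k => by linarith [hab k]
  have ha1 : ∀ k, 0 < a k - 1 := fun k => by linarith [hab k]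
  have hc0 : ∀ k, 0 < b k - a k := fun k => by linarith [hab k]
  have hb0 : ∀ k, 0 < b k := fun k => by linarith [hab k]
  have hb1 : ∀ k, 0 < b k - 1 := fun k => by linarith [hab k]
  set S : Set (Fin (n+1) → ℝ) := Set.univ.pi fun _ => Set.Ioo (0 : ℝ) 1 with hS
  have hmS : MeasurableSet S := (isOpen_set_pi Set.finite_univ fun _ _ => isOpen_Ioo).measurableSet
  obtain ⟨i0, e0⟩ := aux_betaN a (fun k => b k - a k) ha0 hc0
  obtain ⟨i1, e1⟩ := aux_betaN (fun k => a k + 1) (fun k => b k - a k)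
    (fun k => by linarith [ha0 k]) hc0
  obtain ⟨i2, e2⟩ := aux_betaN (fun k => a k - 1) (fun k => b k - a k) ha1 hc0
  rw [← hS] at i0 e0 i1 e1 i2 e2
  set W : (Fin (n+1) → ℝ) → ℝ := fun t => ∏ k, t k ^ (a k - 1) * (1 - t k) ^ (b k - a k - 1) with hW
  set B := ∏ k, ProbabilityTheory.beta (a k) (b k - a k) with hB
  set p := ∏ i, a i / b i with hp
  set m := ∏ i, (a i - 1) / (b i - 1) with hm
  have hp0 : 0 < p := Finset.prod_pos fun k _ => div_pos (ha0 k) (hb0 k)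
  have hm0 : 0 < m := Finset.prod_pos fun k _ => div_pos (ha1 k) (hb1 k)
  have hB0 : 0 < B := Finset.prod_pos fun k _ => ProbabilityTheory.beta_pos (ha0 k) (hc0 k)
  have hWpos : ∀ t ∈ S, 0 < W t := fun t ht => Finset.prod_pos fun k _ => by
    have h := ht k trivial
    exact mul_pos (rpow_pos_of_pos h.1 _) (rpow_pos_of_pos (by linarith [h.2]) _)
  have hTpos : ∀ t ∈ S, 0 < ∏ k, t k := fun t ht => Finset.prod_pos fun k _ => (ht k trivial).1
  have w1 : ∀ t ∈ S, (∏ k, t k ^ (a k + 1 - 1) * (1 - t k) ^ (b k - a k - 1))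
      = W t * ∏ k, t k := fun t ht => by
    rw [hW, ← Finset.prod_mul_distrib]
    refine Finset.prod_congr rfl fun k _ => ?_
    have h := (ht k trivial).1
    rw [show a k + 1 - 1 = (a k - 1) + 1 by ring, rpow_add_one h.ne']
    ring
  have w2 : ∀ t ∈ S, (∏ k, t k ^ (a k - 1 - 1) * (1 - t k) ^ (b k - a k - 1))
      = W t / ∏ k, t k := fun t ht => by
    rw [hW, ← Finset.prod_div_distrib]
    refine Finset.prod_congr rfl fun k _ => ?_
    have h := (ht k trivial).1
    rw [rpow_sub_one h.ne' (a k - 1)]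
    ring
  have E1 : ∏ k, ProbabilityTheory.beta (a k + 1) (b k - a k) = B * p := by
    rw [hB, hp, ← Finset.prod_mul_distrib]
    refine Finset.prod_congr rfl fun k _ => ?_
    rw [aux_beta_succ _ _ (ha0 k) (hc0 k)]
    congr 2; ring
  have E2 : (∏ k, ProbabilityTheory.beta (a k - 1) (b k - a k)) * m = B := by
    rw [hB, hm, ← Finset.prod_mul_distrib]
    refine Finset.prod_congr rfl fun k _ => ?_
    have := aux_beta_succ _ _ (ha1 k) (hc0 k)
    rw [sub_add_cancel] at this
    rw [this]
    congr 2; ring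
  rw [setIntegral_congr_fun hmS w1, E1] at e1
  rw [setIntegral_congr_fun hmS w2] at e2
  replace i1 := (integrableOn_congr_fun w1 hmS).1 i1
  replace i2 := (integrableOn_congr_fun w2 hmS).1 i2
  replace e2 : ∫ t in S, W t / ∏ k, t k = B / m := by
    rw [e2, eq_div_iff hm0.ne']; exact E2
  have hF : hypF 1 a b x = B⁻¹ * ∫ t in S, W t * (1 + (∏ k, t k) * x)⁻¹ := by
    unfold hypF
    congr 1
    · rw [hB, ← Finset.prod_inv_distrib]
      refine Finset.prod_congr rfl fun k _ => ?_
      rw [ProbabilityTheory.beta, inv_div]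
      congr 2; ring
    · rw [← setIntegral_congr_set (s := S)]
      · simp only [rpow_neg_one]
        rfl
      · exact (Measure.pi_Ioo_ae_eq_pi_Icc (s := Set.univ)
          (f := fun _ => (0:ℝ)) (g := fun _ => (1:ℝ)))
  have iF : IntegrableOn (fun t => W t * (1 + (∏ k, t k) * x)⁻¹) S := by
    refine Integrable.mono i0 ?_ ?_
    · exact i0.aestronglyMeasurable.mul (Measurable.aestronglyMeasurable (by fun_prop))
    · filter_upwards [ae_restrict_mem hmS] with t ht
      have h1 := mul_pos (hTpos t ht) hx
      rw [norm_mul]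
      refine mul_le_of_le_one_right (norm_nonneg _) ?_
      rw [norm_inv, Real.norm_of_nonneg (by linarith)]
      exact inv_le_one_of_one_le₀ (by linarith)
  rw [hF]
  constructor
  · have key := aux_lt (fun t => ((1 + 2 * x * p) / (1 + x * p)^2) * W t
      - (x / (1 + x * p)^2) * (W t * ∏ k, t k)) (fun t => W t * (1 + (∏ k, t k) * x)⁻¹) p hp0
      (by exact (i0.const_mul ((1 + 2 * x * p) / (1 + x * p)^2)).sub (i1.const_mul (x / (1 + x * p)^2))) iF
    have id1 : ∀ t ∈ S, W t * (1 + (∏ k, t k) * x)⁻¹ - (((1 + 2 * x * p) / (1 + x * p)^2) * W t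
      - (x / (1 + x * p)^2) * (W t * ∏ k, t k))
      = W t * (x ^ 2 * ((∏ k, t k) - p)^2 / ((1 + (∏ k, t k) * x) * (1 + x * p)^2)) := by
      intro t ht
      have hT := hTpos t ht
      generalize (∏ k, t k) = T at *
      have : 0 < 1 + T * x := by positivity
      field_simp
      ring
    have key := key (fun t ht => by
        have hT := hTpos t ht
        have hw := hWpos t ht
        rw [← sub_nonneg, id1 t ht]; positivity)
      (fun t ht hlt => by
        have hT := hTpos t ht
        have hw := hWpos t ht
        have : (∏ k, t k) - p ≠ 0 := (sub_neg.2 hlt).ne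
        rw [← sub_pos, id1 t ht]; positivity)
    rw [← hS, integral_sub (i0.const_mul _) (i1.const_mul _), integral_const_mul,
      integral_const_mul, e0, e1] at key
    rw [← div_eq_inv_mul, lt_div_iff₀ hB0]
    refine lt_of_eq_of_lt ?_ key
    field_simp
    ring
  · have key := aux_lt (fun t => W t * (1 + (∏ k, t k) * x)⁻¹) (fun t => (1 / (1 + x * m)^2) * W t
      + (x * m ^ 2 / (1 + x * m)^2) * (W t / ∏ k, t k)) m hm0 iF
      (by exact (i0.const_mul (1 / (1 + x * m)^2)).add (i2.const_mul (x * m ^ 2 / (1 + x * m)^2)))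
    have id1 : ∀ t ∈ S, ((1 / (1 + x * m)^2) * W t
      + (x * m ^ 2 / (1 + x * m)^2) * (W t / ∏ k, t k)) - W t * (1 + (∏ k, t k) * x)⁻¹
      = W t * (x * ((∏ k, t k) - m)^2 / ((∏ k, t k) * (1 + (∏ k, t k) * x) * (1 + x * m)^2)) := by
      intro t ht
      have hT := hTpos t ht
      generalize (∏ k, t k) = T at *
      have : 0 < 1 + T * x := by positivity
      field_simp
      ring
    have key := key (fun t ht => by
        have hT := hTpos t ht
        have hw := hWpos t ht
        rw [← sub_nonneg, id1 t ht]; positivity)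
      (fun t ht hlt => by
        have hT := hTpos t ht
        have hw := hWpos t ht
        have : (∏ k, t k) - m ≠ 0 := (sub_neg.2 hlt).ne
        rw [← sub_pos, id1 t ht]; positivity)
    rw [← hS, integral_add (i0.const_mul _) (i2.const_mul _), integral_const_mul,
      integral_const_mul, e0, e2] at key
    rw [← div_eq_inv_mul, div_lt_iff₀ hB0]
    refine lt_of_lt_of_eq key ?_
    field_simp
end

section
/- Let q ≥ 1, b_k > a_k > 1 for k = 1,…,q, 0 < σ ≤ 1 and x > 0. Then F(σ;(a_q);(b_q);−x) < (1 + x ∏_{i=1}^q ((a_i−1)/(b_i−1)))^{−σ}. -/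
open MeasureTheory Real Filter

lemma aux_beta_int (u v : ℝ) (hu : 0 < u) (hv : 0 < v) :
    Integrable (fun t : ℝ => t ^ (u - 1) * (1 - t) ^ (v - 1))
      (volume.restrict (Set.Icc (0:ℝ) 1)) ∧
    ∫ t in Set.Icc (0:ℝ) 1, t ^ (u - 1) * (1 - t) ^ (v - 1)
      = Gamma u * Gamma v / Gamma (u + v) := by
  have hc := Complex.betaIntegral_convergent (u := u) (v := v) (by simpa) (by simpa)
  rw [intervalIntegrable_iff_integrableOn_Ioc_of_le (by simp), IntegrableOn] at hc
  have heq : Set.EqOn (fun t : ℝ => RCLike.re ((t : ℂ) ^ ((u:ℂ) - 1) * (1 - (t : ℂ)) ^ ((v:ℂ) - 1)))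
      (fun t : ℝ => t ^ (u - 1) * (1 - t) ^ (v - 1)) (Set.Ioc 0 1) := by
    intro t ht
    have h1 := ht.1
    have h2 := ht.2
    dsimp only
    norm_cast
    rw [← Complex.ofReal_cpow, ← Complex.ofReal_cpow, RCLike.re_to_complex,
        Complex.re_mul_ofReal, Complex.ofReal_re]
    all_goals linarith
  have hI : IntegrableOn (fun t : ℝ => t ^ (u - 1) * (1 - t) ^ (v - 1)) (Set.Ioc 0 1) :=
    IntegrableOn.congr_fun (f := fun t : ℝ => RCLike.re ((t : ℂ) ^ ((u:ℂ) - 1) * (1 - (t : ℂ)) ^ ((v:ℂ) - 1)))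
      hc.re heq measurableSet_Ioc
  refine ⟨?_, ?_⟩
  · exact (integrableOn_Icc_iff_integrableOn_Ioc).2 hI
  · have := ProbabilityTheory.beta_eq_betaIntegralReal u v hu hv
    rw [ProbabilityTheory.beta] at this
    rw [this, integral_Icc_eq_integral_Ioc, Complex.betaIntegral,
      intervalIntegral.integral_of_le (by norm_num), ← RCLike.re_to_complex, ← integral_re hc]
    exact (setIntegral_congr_fun measurableSet_Ioc heq).symm

lemma aux_tangent (σ x m t : ℝ) (hσ0 : 0 < σ) (hσ1 : σ ≤ 1) (hx : 0 < x) (hm : 0 < m)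
    (ht : 0 ≤ t) :
    t * (1 + t * x) ^ (-σ) + (1 + x * m) ^ (-σ) * (σ * x * (t - m) ^ 2 / ((1 + x * m) * (1 + t * x)))
    ≤ (1 + x * m) ^ (-σ) *
      (m * (σ - σ / (1 + x * m)) + (1 - σ + σ / (1 + x * m)) * t) := by
  have hc : 0 < 1 + x * m := by positivity
  have hu : 0 < 1 + t * x := by positivity
  have h1 := rpow_one_add_le_one_add_mul_self (s := (1 + x * m) / (1 + t * x) - 1)
    (by have := div_pos hc hu; linarith) hσ0.le hσ1
  rw [add_sub_cancel, div_rpow hc.le hu.le] at h1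
  have hcp : 0 < (1 + x * m) ^ σ := rpow_pos_of_pos hc _
  have hup : 0 < (1 + t * x) ^ σ := rpow_pos_of_pos hu _
  rw [rpow_neg hc.le, rpow_neg hu.le]
  have h2 : ((1 + t * x) ^ σ)⁻¹ ≤ ((1 + x * m) ^ σ)⁻¹ * (1 + σ * ((1 + x * m) / (1 + t * x) - 1)) := by
    calc _ = ((1 + x * m) ^ σ)⁻¹ * ((1 + x * m) ^ σ / (1 + t * x) ^ σ) := by field_simp
      _ ≤ _ := by gcongr
  calc _ ≤ t * (((1 + x * m) ^ σ)⁻¹ * (1 + σ * ((1 + x * m) / (1 + t * x) - 1))) + _ := by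
        gcongr
    _ = _ := by
        field_simp
        ring

lemma aux_gamma (a b : ℝ) (ha : 1 < a) (hab : a < b) :
    Gamma a * Gamma (b - a) / Gamma (a + (b - a)) =
     (a - 1) / (b - 1) * (Gamma (a - 1) * Gamma (b - a) / Gamma (a - 1 + (b - a))) := by
  have h1 := Gamma_add_one (s := a - 1) (by linarith)
  have h2 := Gamma_add_one (s := b - 1) (by linarith)
  rw [sub_add_cancel] at h1 h2
  have e1 : a + (b - a) = b := by ring
  have e2 : a - 1 + (b - a) = b - 1 := by ring
  rw [e1, e2, h1, h2]
  have := Gamma_pos_of_pos (s := b - 1) (by linarith)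
  have : b - 1 ≠ 0 := by linarith
  field_simp

/-- Theorem 4: `F(σ;(a_q);(b_q);−x) < (1 + x ∏ (a_i−1)/(b_i−1))^{−σ}` for `0 < σ ≤ 1`, `x > 0`. -/
theorem hypF_upper_general {n : ℕ} (σ : ℝ) (a b : Fin (n + 1) → ℝ)
    (hab : ∀ k, 1 < a k ∧ a k < b k) (hσ0 : 0 < σ) (hσ1 : σ ≤ 1) (x : ℝ) (hx : 0 < x) :
    hypF σ a b x < (1 + x * ∏ i, (a i - 1) / (b i - 1)) ^ (-σ) := by
  set m : ℝ := ∏ i, (a i - 1) / (b i - 1) with hmdef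
  have hm : 0 < m := Finset.prod_pos fun i _ => by
    have := hab i
    exact div_pos (by linarith) (by linarith)
  have hc : 0 < 1 + x * m := by positivity
  set S : Set (Fin (n + 1) → ℝ) := Set.univ.pi fun _ => Set.Icc (0 : ℝ) 1 with hS
  have hSm : MeasurableSet S := MeasurableSet.univ_pi fun _ => measurableSet_Icc
  have hres : (volume.restrict S : Measure (Fin (n + 1) → ℝ)) =
      Measure.pi fun _ => volume.restrict (Set.Icc (0:ℝ) 1) := by
    rw [volume_pi, hS, Measure.restrict_pi_pi]
  let V : (Fin (n + 1) → ℝ) → ℝ := fun t => ∏ k, t k ^ (a k - 1) * (1 - t k) ^ (b k - a k - 1)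
  let W : (Fin (n + 1) → ℝ) → ℝ := fun t => ∏ k, t k ^ (a k - 1 - 1) * (1 - t k) ^ (b k - a k - 1)
  have hVi : IntegrableOn V S := by
    rw [IntegrableOn, hres]
    exact Integrable.fintype_prod (f := fun k (s:ℝ) => s ^ (a k - 1) * (1 - s) ^ (b k - a k - 1))
      fun k => (aux_beta_int (a k) (b k - a k) (by linarith [hab k]) (by linarith [hab k])).1
  have hWi : IntegrableOn W S := by
    rw [IntegrableOn, hres]
    exact Integrable.fintype_prod (f := fun k (s:ℝ) => s ^ (a k - 1 - 1) * (1 - s) ^ (b k - a k - 1))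
      fun k => (aux_beta_int (a k - 1) (b k - a k) (by linarith [hab k]) (by linarith [hab k])).1
  have hVI : ∫ t in S, V t = ∏ k, (Gamma (a k) * Gamma (b k - a k) / Gamma (a k + (b k - a k))) := by
    rw [hres]
    refine (integral_fintype_prod_eq_prod
      (fun k (s:ℝ) => s ^ (a k - 1) * (1 - s) ^ (b k - a k - 1))).trans ?_
    exact Finset.prod_congr rfl fun k _ =>
      (aux_beta_int (a k) (b k - a k) (by linarith [hab k]) (by linarith [hab k])).2
  have hWI : ∫ t in S, W t =
      ∏ k, (Gamma (a k - 1) * Gamma (b k - a k) / Gamma (a k - 1 + (b k - a k))) := by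
    rw [hres]
    refine (integral_fintype_prod_eq_prod
      (fun k (s:ℝ) => s ^ (a k - 1 - 1) * (1 - s) ^ (b k - a k - 1))).trans ?_
    exact Finset.prod_congr rfl fun k _ =>
      (aux_beta_int (a k - 1) (b k - a k) (by linarith [hab k]) (by linarith [hab k])).2
  have hVW : ∫ t in S, V t = m * ∫ t in S, W t := by
    rw [hVI, hWI, hmdef, ← Finset.prod_mul_distrib]
    exact Finset.prod_congr rfl fun k _ => aux_gamma _ _ (hab k).1 (hab k).2
  have hP0 : ∀ t ∈ S, 0 ≤ ∏ k, t k := fun t ht =>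
    Finset.prod_nonneg fun k _ => (ht k trivial).1
  have hWP : ∀ t ∈ S, V t = W t * ∏ k, t k := by
    intro t ht
    simp only [V, W]
    rw [← Finset.prod_mul_distrib]
    refine Finset.prod_congr rfl fun k _ => ?_
    rcases (ht k trivial).1.eq_or_lt with h | h
    · rw [← h, zero_rpow (by linarith [hab k])]; simp
    · rw [rpow_sub_one h.ne' (a k - 1)]; field_simp
  have hW0 : ∀ t ∈ S, 0 ≤ W t := fun t ht => Finset.prod_nonneg fun k _ =>
    mul_nonneg (rpow_nonneg (ht k trivial).1 _) (rpow_nonneg (sub_nonneg.2 (ht k trivial).2) _)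
  let f : (Fin (n + 1) → ℝ) → ℝ := fun t => V t * (1 + (∏ k, t k) * x) ^ (-σ)
  have hfi : IntegrableOn f S := by
    refine Integrable.mono hVi ?_ ?_
    · exact Measurable.aestronglyMeasurable (by fun_prop)
    · refine ae_restrict_of_forall_mem hSm fun t ht => ?_
      have hp := hP0 t ht
      have h1 : 1 ≤ 1 + (∏ k, t k) * x := by nlinarith
      have h2 : (1 + (∏ k, t k) * x) ^ (-σ) ≤ 1 := rpow_le_one_of_one_le_of_nonpos h1 (by linarith)
      have h3 : 0 ≤ (1 + (∏ k, t k) * x) ^ (-σ) := rpow_nonneg (by linarith) _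
      simp only [f, norm_mul]
      rw [Real.norm_of_nonneg h3]
      exact mul_le_of_le_one_right (norm_nonneg _) h2
  let C : ℝ := (1 + x * m) ^ (-σ)
  have hC : 0 < C := rpow_pos_of_pos hc _
  let β : ℝ := 1 - σ + σ / (1 + x * m)
  let g : (Fin (n + 1) → ℝ) → ℝ := fun t => C * (m * (1 - β)) * W t + C * β * V t
  have hgi : IntegrableOn g S := (hWi.const_mul _).add (hVi.const_mul _)
  have hgI : ∫ t in S, g t = C * ∫ t in S, V t := by
    simp only [g]
    rw [integral_add (hWi.const_mul _) (hVi.const_mul _), integral_const_mul, integral_const_mul, hVW]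
    ring
  have hdiff : ∀ t ∈ S, W t * (C * (σ * x * ((∏ k, t k) - m) ^ 2 /
      ((1 + x * m) * (1 + (∏ k, t k) * x)))) ≤ g t - f t := by
    intro t ht
    have := mul_le_mul_of_nonneg_left
      (aux_tangent σ x m (∏ k, t k) hσ0 hσ1 hx hm (hP0 t ht)) (hW0 t ht)
    simp only [g, f, hWP t ht, C, β]
    linarith
  have hpos : 0 < ∫ t in S, (g t - f t) := by
    refine (setIntegral_pos_iff_support_of_nonneg_ae (f := g - f) ?_ (hgi.sub hfi)).2 ?_
    rotate_left
    · let U : Set (Fin (n + 1) → ℝ) :=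
        (Set.univ.pi fun _ => Set.Ioo (0 : ℝ) 1) ∩ {t | (∏ k, t k) ≠ m}
      have hU : IsOpen U := (isOpen_set_pi Set.finite_univ fun _ _ => isOpen_Ioo).inter
        (isOpen_ne_fun (by fun_prop) continuous_const)
      have hne : U.Nonempty := by
        by_cases h : (1/2:ℝ) ^ (n + 1) = m
        · refine ⟨fun _ => 1/3, fun _ _ => by constructor <;> norm_num, ?_⟩
          simp only [Set.mem_setOf_eq, Finset.prod_const, Finset.card_univ, Fintype.card_fin]
          rw [← h]
          exact (pow_lt_pow_left₀ (by norm_num) (by norm_num) (by simp)).ne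
        · refine ⟨fun _ => 1/2, fun _ _ => by constructor <;> norm_num, ?_⟩
          simpa using h
      refine (hU.measure_pos volume hne).trans_le (measure_mono ?_)
      rintro t ⟨ht, htm⟩
      have htS : t ∈ S := fun k hk => ⟨(ht k hk).1.le, (ht k hk).2.le⟩
      refine ⟨?_, htS⟩
      have hWp : 0 < W t := Finset.prod_pos fun k _ =>
        mul_pos (rpow_pos_of_pos (ht k trivial).1 _) (rpow_pos_of_pos (sub_pos.2 (ht k trivial).2) _)
      have h1 : 0 < ((∏ k, t k) - m) ^ 2 := by
        have := sub_ne_zero.2 htm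
        positivity
      have h2 := hP0 t htS
      refine (lt_of_lt_of_le ?_ (hdiff t htS)).ne'
      positivity
    · refine ae_restrict_of_forall_mem hSm fun t ht => ?_
      refine le_trans ?_ (hdiff t ht)
      have := hP0 t ht
      have := hW0 t ht
      simp only [Pi.zero_apply]
      positivity
  rw [integral_sub hgi hfi, hgI] at hpos
  have hK : 0 < ∏ k, Gamma (b k) / (Gamma (a k) * Gamma (b k - a k)) :=
    Finset.prod_pos fun k _ => by
      have := hab k
      exact div_pos (Gamma_pos_of_pos (by linarith))
        (mul_pos (Gamma_pos_of_pos (by linarith)) (Gamma_pos_of_pos (by linarith)))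
  have hKV : (∏ k, Gamma (b k) / (Gamma (a k) * Gamma (b k - a k))) * ∫ t in S, V t = 1 := by
    rw [hVI, ← Finset.prod_mul_distrib]
    refine Finset.prod_eq_one fun k _ => ?_
    have := hab k
    have h1 := Gamma_pos_of_pos (s := b k) (by linarith)
    have h2 := Gamma_pos_of_pos (s := a k) (by linarith)
    have h3 := Gamma_pos_of_pos (s := b k - a k) (by linarith)
    rw [add_sub_cancel]
    field_simp
  calc hypF σ a b x = (∏ k, Gamma (b k) / (Gamma (a k) * Gamma (b k - a k))) * ∫ t in S, f t := rfl
    _ < (∏ k, Gamma (b k) / (Gamma (a k) * Gamma (b k - a k))) * (C * ∫ t in S, V t) :=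
        mul_lt_mul_of_pos_left (by linarith) hK
    _ = C := by rw [mul_left_comm, hKV, mul_one]
end

section
/- Let b > a + 1 > 1 and −1 < x < 0. Then 1/(1 + ax/b) < ₂F₁(1, a; b; −x) < 1/(1 + ax/(b−1)). -/
open MeasureTheory Real

/-- Gauss hypergeometric function `₂F₁(σ, a; b; −x)` via the Euler integral. -/
noncomputable def eulerF21 (σ a b x : ℝ) : ℝ :=
  Gamma b / (Gamma a * Gamma (b - a)) *
    ∫ t in Set.Ioo (0 : ℝ) 1, t ^ (a - 1) * (1 - t) ^ (b - a - 1) * (1 + x * t) ^ (-σ)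

noncomputable def wt (u v t : ℝ) : ℝ := t ^ (u - 1) * (1 - t) ^ (v - 1)

lemma wt_pos {u v t : ℝ} (ht : t ∈ Set.Ioo (0 : ℝ) 1) : 0 < wt u v t :=
  mul_pos (rpow_pos_of_pos ht.1 _) (rpow_pos_of_pos (by linarith [ht.2]) _)

lemma wt_meas (u v : ℝ) : Measurable (wt u v) := by unfold wt; fun_prop

lemma wt_integral {u v : ℝ} (hu : 0 < u) (hv : 0 < v) :
    ∫ t in Set.Ioo (0 : ℝ) 1, wt u v t = Gamma u * Gamma v / Gamma (u + v) := by
  have h0 := ProbabilityTheory.beta_eq_betaIntegralReal u v hu hv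
  unfold ProbabilityTheory.beta at h0
  rw [h0, Complex.betaIntegral, intervalIntegral.integral_of_le (by norm_num),
      ← integral_Ioc_eq_integral_Ioo, ← RCLike.re_to_complex, ← integral_re]
  · refine setIntegral_congr_fun measurableSet_Ioc fun x ⟨hx1, hx₂⟩ ↦ ?_
    unfold wt
    norm_cast
    rw [← Complex.ofReal_cpow, ← Complex.ofReal_cpow, RCLike.re_to_complex,
        Complex.re_mul_ofReal, Complex.ofReal_re]
    all_goals linarith
  · have := Complex.betaIntegral_convergent (u := u) (v := v) (by simpa) (by simpa)
    rwa [intervalIntegrable_iff_integrableOn_Ioc_of_le (by norm_num)] at this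

lemma wt_integral_pos {u v : ℝ} (hu : 0 < u) (hv : 0 < v) :
    0 < ∫ t in Set.Ioo (0 : ℝ) 1, wt u v t := by
  rw [wt_integral hu hv]
  have := Gamma_pos_of_pos hu
  have := Gamma_pos_of_pos hv
  have := Gamma_pos_of_pos (add_pos hu hv)
  positivity

lemma wt_integrable {u v : ℝ} (hu : 0 < u) (hv : 0 < v) :
    IntegrableOn (wt u v) (Set.Ioo (0 : ℝ) 1) :=
  Integrable.of_integral_ne_zero (wt_integral_pos hu hv).ne'

lemma wt_left {u v t : ℝ} (ht : t ∈ Set.Ioo (0 : ℝ) 1) : wt (u + 1) v t = wt u v t * t := by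
  unfold wt
  rw [show u + 1 - 1 = (u - 1) + 1 by ring, rpow_add_one ht.1.ne']; ring

lemma wt_right {u v t : ℝ} (ht : t ∈ Set.Ioo (0 : ℝ) 1) :
    wt u (v + 1) t = wt u v t * (1 - t) := by
  unfold wt
  rw [show v + 1 - 1 = (v - 1) + 1 by ring, rpow_add_one (by linarith [ht.2] : (0:ℝ) < 1 - t).ne']
  ring

lemma wt_moment_integrable {u v : ℝ} (hu : 0 < u) (hv : 0 < v) :
    IntegrableOn (fun t => wt u v t * t) (Set.Ioo (0 : ℝ) 1) :=
  (wt_integrable (u := u + 1) (by linarith) hv).congr_fun (fun _ ht => wt_left ht)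
    measurableSet_Ioo

lemma wt_moment {u v : ℝ} (hu : 0 < u) (hv : 0 < v) :
    ∫ t in Set.Ioo (0 : ℝ) 1, wt u v t * t
      = u / (u + v) * ∫ t in Set.Ioo (0 : ℝ) 1, wt u v t := by
  rw [← setIntegral_congr_fun measurableSet_Ioo (fun _ ht => wt_left ht),
    wt_integral (by linarith) hv, wt_integral hu hv, show u + 1 + v = (u + v) + 1 by ring,
    Gamma_add_one hu.ne', Gamma_add_one (by positivity)]
  have := Gamma_pos_of_pos (add_pos hu hv)
  field_simp

lemma wt_centered_integrable {u v : ℝ} (hu : 0 < u) (hv : 0 < v) (k : ℝ) :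
    IntegrableOn (fun t => k * (wt u v t * t - u / (u + v) * wt u v t)) (Set.Ioo (0 : ℝ) 1) :=
  ((wt_moment_integrable hu hv).sub ((wt_integrable hu hv).const_mul _)).const_mul _

lemma wt_centered {u v : ℝ} (hu : 0 < u) (hv : 0 < v) (k : ℝ) :
    ∫ t in Set.Ioo (0 : ℝ) 1, k * (wt u v t * t - u / (u + v) * wt u v t) = 0 := by
  rw [integral_const_mul, integral_sub (wt_moment_integrable hu hv)
    ((wt_integrable hu hv).const_mul _), integral_const_mul, wt_moment hu hv]
  ring

lemma wt_div_integrable {u v x : ℝ} (hu : 0 < u) (hv : 0 < v) (hx1 : -1 < x) (hx0 : x < 0) :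
    IntegrableOn (fun t => wt u v t * (1 + x * t)⁻¹) (Set.Ioo (0 : ℝ) 1) := by
  refine Integrable.mono' ((wt_integrable hu hv).mul_const (1 + x)⁻¹) ?_ ?_
  · have := wt_meas u v
    exact (by fun_prop : Measurable (fun t => wt u v t * (1 + x * t)⁻¹)).aestronglyMeasurable
  · refine (ae_restrict_iff' measurableSet_Ioo).2 (Filter.Eventually.of_forall fun t ht => ?_)
    have h1 : 0 < 1 + x := by linarith
    have h2 : 1 + x ≤ 1 + x * t := by nlinarith [ht.2]
    have h3 := wt_pos (u := u) (v := v) ht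
    have h4 : 0 < 1 + x * t := by linarith
    rw [norm_of_nonneg (by positivity)]
    gcongr

lemma integral_pos_aux {f : ℝ → ℝ} {m : ℝ} (hf : IntegrableOn f (Set.Ioo (0 : ℝ) 1))
    (h0 : ∀ t ∈ Set.Ioo (0 : ℝ) 1, 0 ≤ f t)
    (h1 : ∀ t ∈ Set.Ioo (0 : ℝ) 1, t ≠ m → 0 < f t) :
    0 < ∫ t in Set.Ioo (0 : ℝ) 1, f t := by
  rw [setIntegral_pos_iff_support_of_nonneg_ae
    ((ae_restrict_iff' measurableSet_Ioo).2 (Filter.Eventually.of_forall h0)) hf]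
  have : volume (Set.Ioo (0 : ℝ) 1 \ {m}) = 1 := by
    rw [measure_sdiff_null (by simp)]; simp
  refine lt_of_lt_of_le (by rw [this]; exact one_pos) (measure_mono (μ := volume)
    (s := Set.Ioo (0 : ℝ) 1 \ {m}) fun t ht => ⟨(h1 t ht.1 ht.2).ne', ht.1⟩)

/-- For `b > a + 1 > 1` and `−1 < x < 0`:
`1/(1 + ax/b) < ₂F₁(1, a; b; −x) < 1/(1 + ax/(b−1))`. -/
theorem eulerF21_two_sided (a b x : ℝ) (hb : a + 1 < b) (ha : 1 < a + 1)
    (hx1 : -1 < x) (hx0 : x < 0) :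
    1 / (1 + a * x / b) < eulerF21 1 a b x ∧
      eulerF21 1 a b x < 1 / (1 + a * x / (b - 1)) := by
  have ha0 : 0 < a := by linarith
  have hv : 0 < b - a := by linarith
  have hv' : 0 < b - a - 1 := by linarith
  have hK := wt_integral_pos ha0 hv
  have hF : eulerF21 1 a b x = (∫ t in Set.Ioo (0 : ℝ) 1, wt a (b - a) t * (1 + x * t)⁻¹) /
      ∫ t in Set.Ioo (0 : ℝ) 1, wt a (b - a) t := by
    rw [wt_integral ha0 hv, show a + (b - a) = b by ring]
    unfold eulerF21 wt
    simp only [rpow_neg_one]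
    rw [div_div_eq_mul_div]
    ring
  have hI := wt_div_integrable ha0 hv hx1 hx0
  have hW := wt_integrable ha0 hv
  rw [hF]
  have hpos : ∀ t ∈ Set.Ioo (0 : ℝ) 1, 0 < 1 + x * t := fun t ht => by nlinarith [ht.1, ht.2]
  constructor
  · set m := a / (a + (b - a)) with hm
    have hmI : m ∈ Set.Ioo (0 : ℝ) 1 := by
      constructor
      · rw [hm]; positivity
      · rw [hm, div_lt_one (by linarith)]; linarith
    have hc := hpos m hmI
    rw [show 1 + a * x / b = 1 + x * m by rw [hm, show a + (b - a) = b by ring]; ring,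
      lt_div_iff₀ hK]
    set k := -x / (1 + x * m) ^ 2 with hk
    have hC := wt_centered_integrable ha0 hv k
    have hid : ∀ t ∈ Set.Ioo (0 : ℝ) 1, wt a (b - a) t * (1 + x * t)⁻¹
        - 1 / (1 + x * m) * wt a (b - a) t - k * (wt a (b - a) t * t - m * wt a (b - a) t)
        = wt a (b - a) t * (x ^ 2 * (t - m) ^ 2 / ((1 + x * m) ^ 2 * (1 + x * t))) := by
      intro t ht
      have := hpos t ht
      rw [hk]
      generalize m = m at *
      field_simp
      ring
    have key := integral_pos_aux (m := m) ((hI.sub (hW.const_mul (1 / (1 + x * m)))).sub hC)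
      (fun t ht => by
        simp only [Pi.sub_apply]
        rw [hid t ht]
        have := hpos t ht
        have := wt_pos (u := a) (v := b - a) ht
        positivity)
      (fun t ht htm => by
        simp only [Pi.sub_apply]
        rw [hid t ht]
        have := hpos t ht
        have := wt_pos (u := a) (v := b - a) ht
        have := sub_ne_zero.2 htm
        have := hx0.ne
        positivity)
    rw [integral_sub' (hI.sub (hW.const_mul _)) hC, integral_sub' hI (hW.const_mul _),
      wt_centered ha0 hv, integral_const_mul] at key
    linarith
  · set p := a / (a + (b - a - 1)) with hp
    have hpI : p ∈ Set.Ioo (0 : ℝ) 1 := by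
      constructor
      · rw [hp]; positivity
      · rw [hp, div_lt_one (by linarith)]; linarith
    have hc := hpos p hpI
    rw [show 1 + a * x / (b - 1) = 1 + x * p by
        rw [hp, show a + (b - a - 1) = b - 1 by ring]; ring,
      div_lt_iff₀ hK]
    set k := -x * (1 - p) / (1 + x * p) ^ 2 with hk
    have hC := wt_centered_integrable ha0 hv' k
    have hid : ∀ t ∈ Set.Ioo (0 : ℝ) 1, 1 / (1 + x * p) * wt a (b - a) t
        + k * (wt a (b - a - 1) t * t - p * wt a (b - a - 1) t) - wt a (b - a) t * (1 + x * t)⁻¹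
        = wt a (b - a - 1) t *
          ((1 + x) * (-x) * (t - p) ^ 2 / ((1 + x * p) ^ 2 * (1 + x * t))) := by
      intro t ht
      have := hpos t ht
      have h := wt_right (u := a) (v := b - a - 1) ht
      rw [sub_add_cancel] at h
      rw [hk, h]
      generalize p = p at *
      field_simp
      ring
    have e1 : 0 < 1 + x := by linarith
    have e2 : 0 < -x := by linarith
    have key := integral_pos_aux (m := p) (((hW.const_mul (1 / (1 + x * p))).add hC).sub hI)
      (fun t ht => by
        simp only [Pi.sub_apply, Pi.add_apply]
        rw [hid t ht]
        have := hpos t ht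
        have := wt_pos (u := a) (v := b - a - 1) ht
        positivity)
      (fun t ht htm => by
        simp only [Pi.sub_apply, Pi.add_apply]
        rw [hid t ht]
        have := hpos t ht
        have := wt_pos (u := a) (v := b - a - 1) ht
        have := sub_ne_zero.2 htm
        positivity)
    rw [integral_sub' ((hW.const_mul _).add hC) hI, integral_add' (hW.const_mul _) hC,
      wt_centered ha0 hv', integral_const_mul] at key
    linarith
end

section
/- Let a, b, c, d, e be real with d + e − b − c > 0, b > 0, c > 0, and let −1 < x < 1. Then ₃F₂(a, b, c; d, e; x) = [Γ(d)Γ(e)/(Γ(b)Γ(c)Γ(d+e−b−c))] ∫_0^1 t^{b−1}(1−t)^{d+e−b−c−1}(1−xt)^{−a} ₂F₁(e−c, d−c; d+e−b−c; 1−t) dt. -/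
open MeasureTheory Real

/-- Pochhammer symbol `(a)_n = a(a+1)⋯(a+n−1)`. -/
noncomputable def poch (a : ℝ) (n : ℕ) : ℝ := (ascPochhammer ℝ n).eval a

/-- Gauss hypergeometric series `₂F₁(α, β; γ; y)`. -/
noncomputable def F21 (α β γ y : ℝ) : ℝ :=
  ∑' n : ℕ, poch α n * poch β n / (poch γ n * (n.factorial : ℝ)) * y ^ n

/-- Generalized hypergeometric series `₃F₂(a, b, c; d, e; x)`. -/
noncomputable def F32 (a b c d e x : ℝ) : ℝ :=
  ∑' n : ℕ, poch a n * poch b n * poch c n / (poch d n * poch e n * (n.factorial : ℝ)) * x ^ n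


open Filter Topology

lemma poch_zero' (a : ℝ) : poch a 0 = 1 := by simp [poch]

lemma poch_succ' (a : ℝ) (n : ℕ) : poch a (n + 1) = poch a n * (a + n) := by
  simp [poch, ascPochhammer_succ_right]

lemma poch_pos' {a : ℝ} (ha : 0 < a) (n : ℕ) : 0 < poch a n := by
  induction n with
  | zero => simp [poch_zero']
  | succ n ih => rw [poch_succ']; positivity

lemma poch_mono' {a b : ℝ} (ha : 0 < a) (hab : a ≤ b) (n : ℕ) : poch a n ≤ poch b n := by
  induction n with
  | zero => simp [poch_zero']
  | succ n ih =>
    rw [poch_succ', poch_succ']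
    have := poch_pos' ha n
    have := this.trans_le ih
    gcongr

lemma poch_prod (a : ℝ) (n : ℕ) : poch a n = ∏ j ∈ Finset.range n, (a + j) := by
  induction n with
  | zero => simp [poch_zero']
  | succ n ih => rw [poch_succ', Finset.prod_range_succ, ih]

lemma poch_shift (a : ℝ) (n : ℕ) : poch (a + 1) n * a = poch a n * (a + n) := by
  induction n with
  | zero => simp [poch_zero']
  | succ n ih =>
    rw [poch_succ', poch_succ']
    push_cast
    linear_combination (a + 1 + n) * ih

lemma Gamma_add_nat' {a : ℝ} (ha : 0 < a) (n : ℕ) : Gamma (a + n) = poch a n * Gamma a := by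
  induction n with
  | zero => simp [poch_zero']
  | succ n ih =>
    rw [poch_succ']
    push_cast
    rw [← add_assoc, Real.Gamma_add_one (by positivity), ih]
    ring

/-- The term of `₂F₁` at `1`. -/
noncomputable def gu (α β γ : ℝ) (k : ℕ) : ℝ :=
  poch α k * poch β k / (poch γ k * (k.factorial : ℝ))

lemma gu_zero (α β γ : ℝ) : gu α β γ 0 = 1 := by simp [gu, poch_zero']

lemma gu_succ {α β γ : ℝ} (hγ : 0 < γ) (k : ℕ) :
    ((k : ℝ) + 1) * gu α β γ (k + 1) = (α + k) * (β + k) / (γ + k) * gu α β γ k := by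
  have h1 := (poch_pos' hγ k).ne'
  have h2 : γ + k ≠ 0 := by positivity
  have h3 : (k.factorial : ℝ) ≠ 0 := by positivity
  have h4 : (k : ℝ) + 1 ≠ 0 := by positivity
  simp only [gu, poch_succ', Nat.factorial_succ]
  push_cast
  field_simp

lemma raabe (w : ℕ → ℝ) (hw : ∀ k, 0 ≤ w k) (ε : ℝ) (hε : 0 < ε)
    (h : ∀ᶠ k : ℕ in atTop, ε * w k ≤ k * w k - (k + 1) * w (k + 1)) :
    Summable w := by
  obtain ⟨K, hK⟩ := eventually_atTop.1 h
  rw [← summable_nat_add_iff K]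
  have key : ∀ n : ℕ, ∑ i ∈ Finset.range n, ε * w (i + K) ≤
      K * w K - ((n + K : ℕ) : ℝ) * w (n + K) := by
    intro n
    induction n with
    | zero => simp
    | succ n ih =>
      rw [Finset.sum_range_succ]
      have := hK (n + K) (by omega)
      rw [show n + 1 + K = n + K + 1 by ring]
      push_cast at *
      linarith
  have hs : Summable (fun i => ε * w (i + K)) := by
    refine summable_of_sum_range_le (c := K * w K) (fun n => mul_nonneg hε.le (hw _)) ?_
    intro n
    refine (key n).trans ?_
    have : 0 ≤ ((n + K : ℕ) : ℝ) * w (n + K) := mul_nonneg (by positivity) (hw _)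
    linarith
  exact (summable_mul_left_iff hε.ne').1 hs

lemma gu_summable {α β γ : ℝ} (hγ : 0 < γ) (hδ : 0 < γ - α - β) :
    Summable (fun k => |gu α β γ k|) := by
  refine raabe _ (fun k => abs_nonneg _) ((γ - α - β) / 2) (by linarith) ?_
  have e1 := tendsto_natCast_atTop_atTop (R := ℝ) |>.eventually_ge_atTop (-α)
  have e2 := tendsto_natCast_atTop_atTop (R := ℝ) |>.eventually_ge_atTop (-β)
  have e3 := tendsto_natCast_atTop_atTop (R := ℝ) |>.eventually_ge_atTop
    ((α * β + (γ - α - β) / 2 * γ) / ((γ - α - β) / 2))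
  filter_upwards [e1, e2, e3] with k h1 h2 h3
  rw [div_le_iff₀ (by linarith)] at h3
  have hk : 0 < γ + k := by positivity
  have h4 : ((k : ℝ) + 1) * |gu α β γ (k + 1)| = (α + k) * (β + k) / (γ + k) * |gu α β γ k| := by
    have h5 : (0 : ℝ) < k + 1 := by positivity
    have h6 : 0 ≤ (α + k) * (β + k) / (γ + k) :=
      div_nonneg (mul_nonneg (by linarith) (by linarith)) hk.le
    rw [← abs_of_pos h5, ← abs_mul, gu_succ hγ, abs_mul, abs_of_nonneg h6]
  rw [h4, ← sub_mul]
  refine mul_le_mul_of_nonneg_right ?_ (abs_nonneg _)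
  rw [le_sub_iff_add_le, ← le_sub_iff_add_le', div_le_iff₀ hk]
  nlinarith

lemma gu_shift {α β γ : ℝ} (hγ : 0 < γ) (k : ℕ) :
    (γ + k) * gu α β (γ + 1) k = γ * gu α β γ k := by
  have h1 := (poch_pos' hγ k).ne'
  have h2 := (poch_pos' (show 0 < γ + 1 by linarith) k).ne'
  have h3 : (k.factorial : ℝ) ≠ 0 := by positivity
  have h := poch_shift γ k
  simp only [gu]
  field_simp
  linear_combination (-poch α k * poch β k) * h

lemma gu_contig {α β γ : ℝ} (hγ : 0 < γ) (hδ : 0 < γ - α - β) :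
    γ * (γ - α - β) * ∑' k, gu α β γ k = (γ - α) * (γ - β) * ∑' k, gu α β (γ + 1) k := by
  have s1 : Summable (gu α β γ) := (gu_summable hγ hδ).of_abs
  have s2 : Summable (gu α β (γ + 1)) :=
    (gu_summable (show 0 < γ + 1 by linarith) (by linarith)).of_abs
  set f : ℕ → ℝ := fun k => γ * (γ - α - β) * gu α β γ k - (γ - α) * (γ - β) * gu α β (γ + 1) k
    with hf
  have sf : HasSum f (γ * (γ - α - β) * ∑' k, gu α β γ k
      - (γ - α) * (γ - β) * ∑' k, gu α β (γ + 1) k) :=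
    (s1.hasSum.mul_left _).sub (s2.hasSum.mul_left _)
  have tel : ∀ n : ℕ, ∑ i ∈ Finset.range n, f i = - (γ * (n * gu α β γ n)) := by
    intro n
    induction n with
    | zero => simp
    | succ n ih =>
      rw [Finset.sum_range_succ, ih, hf]
      push_cast
      rw [gu_succ hγ]
      have h1 : γ + n ≠ 0 := by positivity
      have h2 : gu α β (γ + 1) n = γ * gu α β γ n / (γ + n) := by
        rw [eq_div_iff h1, ← gu_shift hγ]; ring
      simp only [h2]
      field_simp
      ring
  have lim := sf.tendsto_sum_nat
  simp only [tel] at lim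
  set L := γ * (γ - α - β) * ∑' k, gu α β γ k - (γ - α) * (γ - β) * ∑' k, gu α β (γ + 1) k with hL
  suffices L = 0 by linarith
  by_contra hne
  have lim2 : Tendsto (fun n : ℕ => |γ * (n * gu α β γ n)|) atTop (𝓝 |L|) := by
    simpa using lim.abs
  have hpos : |L| / 2 < |L| := by have := abs_pos.2 hne; linarith
  have ev := lim2.eventually (lt_mem_nhds hpos)
  apply Real.not_summable_one_div_natCast
  have s3 : Summable (fun k => (γ * 2 / |L|) * |gu α β γ k|) := (gu_summable hγ hδ).mul_left _
  refine Summable.of_norm_bounded_eventually_nat s3 ?_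
  filter_upwards [ev, eventually_gt_atTop 0] with n hn hn0
  have hn0' : (0 : ℝ) < n := by exact_mod_cast hn0
  have hLp := abs_pos.2 hne
  rw [abs_mul, abs_mul, abs_of_pos hγ, abs_of_pos hn0'] at hn
  rw [Real.norm_of_nonneg (by positivity), div_mul_eq_mul_div, div_le_div_iff₀ hn0' hLp]
  linarith

lemma gu_iter {α β γ : ℝ} (hγ : 0 < γ) (hδ : 0 < γ - α - β) (m : ℕ) :
    poch γ m * poch (γ - α - β) m * ∑' k, gu α β γ k =
      poch (γ - α) m * poch (γ - β) m * ∑' k, gu α β (γ + m) k := by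
  induction m with
  | zero => simp [poch_zero']
  | succ m ih =>
    have h := gu_contig (α := α) (β := β) (γ := γ + m) (by positivity)
      (by have : (0 : ℝ) ≤ m := by positivity
          linarith)
    simp only [poch_succ']
    push_cast
    rw [← add_assoc]
    linear_combination (γ + m) * (γ - α - β + m) * ih + poch (γ - α) m * poch (γ - β) m * h

lemma gu_lim {α β γ : ℝ} (hγ : 0 < γ) (hδ : 0 < γ - α - β) :
    Tendsto (fun m : ℕ => ∑' k, gu α β (γ + m) k) atTop (𝓝 1) := by
  have h1 : (1 : ℝ) = ∑' k : ℕ, if k = 0 then (1 : ℝ) else 0 := by simp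
  rw [h1]
  refine tendsto_tsum_of_dominated_convergence (gu_summable hγ hδ) ?_ ?_
  · intro k
    rcases k with _ | k
    · simp [gu_zero]
    · simp only [Nat.succ_ne_zero, if_false]
      have hA : Tendsto (fun m : ℕ => poch α (k+1) * poch β (k+1) / ((k+1).factorial : ℝ)
          / (poch (γ + m) (k+1))) atTop (𝓝 0) := by
        refine Tendsto.div_atTop tendsto_const_nhds ?_
        have hB : Tendsto (fun m : ℕ => poch γ k * (γ + m + k)) atTop atTop := by
          refine Tendsto.const_mul_atTop (poch_pos' hγ k) ?_
          refine tendsto_atTop_add_const_right _ _ ?_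
          exact tendsto_atTop_add_const_left _ _ tendsto_natCast_atTop_atTop
        refine tendsto_atTop_mono (fun m => ?_) hB
        rw [poch_succ']
        have := poch_mono' hγ (show γ ≤ γ + m by simp) k
        gcongr
      refine hA.congr (fun m => ?_)
      rw [gu, div_div, mul_comm (poch (γ + m) (k+1))]
  · refine Eventually.of_forall (fun m k => ?_)
    have h3 := poch_pos' hγ k
    have h4 := poch_mono' hγ (show γ ≤ γ + m by simp) k
    rw [Real.norm_eq_abs, gu, gu, abs_div, abs_div]
    have h5 : (0 : ℝ) < k.factorial := by positivity
    rw [abs_of_pos (mul_pos h3 h5), abs_of_pos (mul_pos (h3.trans_le h4) h5)]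
    gcongr

lemma gauss {α β γ : ℝ} (hγ : 0 < γ) (hδ : 0 < γ - α - β) (hα : 0 < γ - α) (hβ : 0 < γ - β) :
    ∑' k, gu α β γ k = Gamma γ * Gamma (γ - α - β) / (Gamma (γ - α) * Gamma (γ - β)) := by
  have g := fun s => Real.GammaSeq_tendsto_Gamma s
  have lim1 := ((g γ).mul (g (γ - α - β))).div ((g (γ - α)).mul (g (γ - β)))
    (mul_pos (Gamma_pos_of_pos hα) (Gamma_pos_of_pos hβ)).ne'
  have lim2 := lim1.mul ((gu_lim (α := α) (β := β) hγ hδ).comp (tendsto_add_atTop_nat 1))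
  rw [mul_one] at lim2
  refine tendsto_nhds_unique (f := fun _ : ℕ => ∑' k, gu α β γ k) (l := atTop)
    tendsto_const_nhds (lim2.congr' ?_)
  filter_upwards [eventually_gt_atTop 0] with m hm
  have hm' : (0 : ℝ) < m := by exact_mod_cast hm
  have it := gu_iter (α := α) (β := β) hγ hδ (m + 1)
  have p1 := (poch_pos' hγ (m+1)).ne'
  have p2 := (poch_pos' hδ (m+1)).ne'
  have p3 := (poch_pos' hα (m+1)).ne'
  have p4 := (poch_pos' hβ (m+1)).ne'
  simp only [Function.comp, Real.GammaSeq, ← poch_prod, Pi.div_apply]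
  have r : (m : ℝ) ^ γ * (m : ℝ) ^ (γ - α - β) = (m : ℝ) ^ (γ - α) * (m : ℝ) ^ (γ - β) := by
    rw [← rpow_add hm', ← rpow_add hm']; congr 1; ring
  have q1 := (rpow_pos_of_pos hm' γ).ne'
  have q2 := (rpow_pos_of_pos hm' (γ - α - β)).ne'
  have q3 := (rpow_pos_of_pos hm' (γ - α)).ne'
  have q4 := (rpow_pos_of_pos hm' (γ - β)).ne'
  have h3 : (m.factorial : ℝ) ≠ 0 := by positivity
  set S := ∑' k, gu α β γ k
  set S' := ∑' k, gu α β (γ + ((m + 1 : ℕ) : ℝ)) k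
  have hS : S = poch (γ - α) (m+1) * poch (γ - β) (m+1) * S' /
      (poch γ (m+1) * poch (γ - α - β) (m+1)) := by
    rw [eq_div_iff (mul_ne_zero p1 p2), ← it]; ring
  rw [hS]
  generalize (m : ℝ) ^ γ = R1 at *
  generalize (m : ℝ) ^ (γ - α - β) = R2 at *
  generalize (m : ℝ) ^ (γ - α) = R3 at *
  generalize (m : ℝ) ^ (γ - β) = R4 at *
  field_simp
  linear_combination S' * r

lemma beta_real {p q : ℝ} (hp : 0 < p) (hq : 0 < q) :
    IntegrableOn (fun t : ℝ => t ^ (p - 1) * (1 - t) ^ (q - 1)) (Set.Ioo 0 1) ∧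
    ∫ t in Set.Ioo (0 : ℝ) 1, t ^ (p - 1) * (1 - t) ^ (q - 1) =
      Gamma p * Gamma q / Gamma (p + q) := by
  have hc := Complex.betaIntegral_convergent (u := p) (v := q) (by simpa) (by simpa)
  rw [intervalIntegrable_iff_integrableOn_Ioo_of_le (by simp)] at hc
  have hcong : Set.EqOn (fun x : ℝ => (x : ℂ) ^ ((p : ℂ) - 1) * (1 - (x : ℂ)) ^ ((q : ℂ) - 1))
      (fun t : ℝ => ((t ^ (p - 1) * (1 - t) ^ (q - 1) : ℝ) : ℂ)) (Set.Ioo 0 1) := by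
    intro t ht
    have h1 : 0 ≤ t := ht.1.le
    have h2 : 0 ≤ 1 - t := by linarith [ht.2]
    push_cast
    rw [Complex.ofReal_cpow h1, Complex.ofReal_cpow h2]
    push_cast
    rfl
  have hI : IntegrableOn (fun t : ℝ => t ^ (p - 1) * (1 - t) ^ (q - 1)) (Set.Ioo 0 1) := by
    have := (hc.congr_fun hcong measurableSet_Ioo).re
    simpa [IntegrableOn] using this
  refine ⟨hI, ?_⟩
  have hb := ProbabilityTheory.beta_eq_betaIntegralReal p q hp hq
  rw [ProbabilityTheory.beta, Complex.betaIntegral, intervalIntegral.integral_of_le (by simp),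
    integral_Ioc_eq_integral_Ioo, setIntegral_congr_fun measurableSet_Ioo hcong,
    integral_complex_ofReal, Complex.ofReal_re] at hb
  exact hb.symm

lemma integrable_tsum' {X : Type*} [MeasurableSpace X] {μ : Measure X} {F : ℕ → X → ℝ}
    (hF : ∀ i, Integrable (F i) μ) (hS : Summable fun i => ∫ a, ‖F i a‖ ∂μ) :
    Integrable (fun a => ∑' i, F i a) μ := by
  refine ⟨(AEMeasurable.tsum fun i => (hF i).1.aemeasurable).aestronglyMeasurable, ?_⟩
  have h1 : ∫⁻ a, ‖∑' i, F i a‖ₑ ∂μ ≤ ∑' i, ∫⁻ a, ‖F i a‖ₑ ∂μ := by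
    rw [← lintegral_tsum (fun i => (hF i).1.enorm)]
    exact lintegral_mono fun a => enorm_tsum_le_tsum_enorm
  refine lt_of_le_of_lt h1 (lt_top_iff_ne_top.2 ?_)
  have h2 (i : ℕ) : ∫⁻ a, ‖F i a‖ₑ ∂μ = ENNReal.ofReal (∫ a, ‖F i a‖ ∂μ) := by
    rw [ofReal_integral_norm_eq_lintegral_enorm (hF i)]
  simp only [h2]
  exact hS.tsum_ofReal_ne_top

lemma binom {a y : ℝ} (hy : |y| < 1) :
    Summable (fun n : ℕ => |poch a n / (n.factorial : ℝ) * y ^ n|) ∧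
    HasSum (fun n : ℕ => poch a n / (n.factorial : ℝ) * y ^ n) ((1 - y) ^ (-a)) := by
  have H : ∀ y : ℝ, |y| < 1 →
    HasSum (fun n : ℕ => poch a n / (n.factorial : ℝ) * y ^ n) ((1 - y) ^ (-a)) := by
    intro y hy
    have h := (Real.one_div_one_sub_rpow_hasFPowerSeriesOnBall_zero a).hasSum (y := y)
      (by simpa [enorm_eq_nnnorm, ← NNReal.coe_lt_coe] using hy)
    have h1 : 0 ≤ 1 - y := by linarith [le_abs_self y]
    rw [zero_add, one_div, ← rpow_neg h1] at h
    have e : (fun n : ℕ => poch a n / (n.factorial : ℝ) * y ^ n) = fun n : ℕ =>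
        (FormalMultilinearSeries.ofScalars ℝ (fun n : ℕ => Ring.choose (a + n - 1) n) n)
          fun _ : Fin n => y := by
     funext n
     rw [FormalMultilinearSeries.ofScalars_apply_eq, smul_eq_mul]
     congr 1
     rw [← Ring.multichoose_eq, div_eq_iff (by positivity)]
     have := Ring.factorial_nsmul_multichoose_eq_ascPochhammer a n
     rw [Polynomial.ascPochhammer_smeval_eq_eval, nsmul_eq_mul] at this
     rw [poch, ← this, mul_comm]
    rw [e]
    exact h
  exact ⟨(H y hy).summable.abs, H y hy⟩

lemma moment {α β s p : ℝ} (hs : 0 < s) (hp : 0 < p) (hδ : 0 < p + s - α - β)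
    (hα : 0 < p + s - α) (hβ : 0 < p + s - β) :
    IntegrableOn (fun t : ℝ => t ^ (p - 1) * (1 - t) ^ (s - 1) * F21 α β s (1 - t))
      (Set.Ioo 0 1) ∧
    ∫ t in Set.Ioo (0 : ℝ) 1, t ^ (p - 1) * (1 - t) ^ (s - 1) * F21 α β s (1 - t) =
      Gamma p * Gamma s * Gamma (p + s - α - β) / (Gamma (p + s - α) * Gamma (p + s - β)) := by
  have hps : 0 < p + s := by linarith
  set F : ℕ → ℝ → ℝ := fun k t => gu α β s k * (t ^ (p - 1) * (1 - t) ^ (s + k - 1)) with hF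
  have hB := fun k : ℕ => beta_real (p := p) (q := s + k) hp (by positivity)
  have hFi : ∀ k, Integrable (F k) (volume.restrict (Set.Ioo 0 1)) := fun k =>
    (hB k).1.const_mul _
  have hval : ∀ k : ℕ, Gamma p * Gamma (s + k) / Gamma (p + (s + k)) =
      Gamma p * Gamma s / Gamma (p + s) * (poch s k / poch (p + s) k) := by
    intro k
    rw [← add_assoc, Gamma_add_nat' hs, Gamma_add_nat' hps]
    have := (poch_pos' hps k).ne'
    have := (Gamma_pos_of_pos hps).ne'
    field_simp
  have hgu : ∀ k : ℕ, gu α β s k * (poch s k / poch (p + s) k) = gu α β (p + s) k := by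
    intro k
    have := (poch_pos' hps k).ne'
    have := (poch_pos' hs k).ne'
    simp only [gu]
    field_simp
  have hint : ∀ k, ∫ t in Set.Ioo (0 : ℝ) 1, F k t =
      Gamma p * Gamma s / Gamma (p + s) * gu α β (p + s) k := by
    intro k
    simp only [hF]
    rw [integral_const_mul, (hB k).2, hval, ← hgu]
    ring
  have hnorm : ∀ k, ∫ t in Set.Ioo (0 : ℝ) 1, ‖F k t‖ =
      Gamma p * Gamma s / Gamma (p + s) * |gu α β (p + s) k| := by
    intro k
    have e : ∫ t in Set.Ioo (0 : ℝ) 1, ‖F k t‖ =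
        ∫ t in Set.Ioo (0 : ℝ) 1, |gu α β s k| * (t ^ (p - 1) * (1 - t) ^ (s + k - 1)) := by
      refine setIntegral_congr_fun measurableSet_Ioo (fun t ht => ?_)
      have h1 : 0 ≤ t := ht.1.le
      have h2 : 0 ≤ 1 - t := by linarith [ht.2]
      simp only [hF]
      rw [norm_mul, Real.norm_eq_abs, Real.norm_of_nonneg (by positivity)]
    rw [e, integral_const_mul, (hB k).2, hval, ← hgu, abs_mul,
      abs_of_pos (div_pos (poch_pos' hs k) (poch_pos' hps k))]
    ring
  have hsum : Summable fun k => ∫ t in Set.Ioo (0 : ℝ) 1, ‖F k t‖ := by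
    simp only [hnorm]
    exact (gu_summable hps hδ).mul_left _
  have hcong : Set.EqOn (fun t => ∑' k, F k t)
      (fun t : ℝ => t ^ (p - 1) * (1 - t) ^ (s - 1) * F21 α β s (1 - t)) (Set.Ioo 0 1) := by
    intro t ht
    have h2 : 0 < 1 - t := by linarith [ht.2]
    simp only [F21]
    rw [← tsum_mul_left]
    refine tsum_congr (fun k => ?_)
    simp only [hF, gu]
    rw [show s + k - 1 = (s - 1) + k by ring, rpow_add h2, rpow_natCast]
    ring
  refine ⟨IntegrableOn.congr_fun (integrable_tsum' hFi hsum) hcong measurableSet_Ioo, ?_⟩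
  rw [← setIntegral_congr_fun measurableSet_Ioo hcong,
    ← integral_tsum_of_summable_integral_norm hFi hsum]
  simp only [hint]
  rw [tsum_mul_left, gauss hps hδ hα hβ]
  have := (Gamma_pos_of_pos hps).ne'
  field_simp

/-- Lemma 2: integral representation of `₃F₂` in terms of `₂F₁`. -/
theorem F32_integral_repr (a b c d e x : ℝ) (hbc : 0 < d + e - b - c)
    (hb : 0 < b) (hc : 0 < c) (hd : 0 < d) (he : 0 < e) (hx1 : -1 < x) (hx2 : x < 1) :
    F32 a b c d e x =
      Gamma d * Gamma e / (Gamma b * Gamma c * Gamma (d + e - b - c)) *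
        ∫ t in Set.Ioo (0 : ℝ) 1,
          t ^ (b - 1) * (1 - t) ^ (d + e - b - c - 1) * (1 - x * t) ^ (-a) *
            F21 (e - c) (d - c) (d + e - b - c) (1 - t) := by
  have hx : |x| < 1 := abs_lt.2 ⟨hx1, hx2⟩
  set s := d + e - b - c with hs
  have hM := fun n : ℕ => moment (α := e - c) (β := d - c) (s := s) (p := b + n) hbc
    (by positivity)
    (by have : (0 : ℝ) ≤ n := by positivity
        linarith)
    (by have : (0 : ℝ) ≤ n := by positivity
        linarith)
    (by have : (0 : ℝ) ≤ n := by positivity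
        linarith)
  have hval : ∀ n : ℕ, ∫ t in Set.Ioo (0 : ℝ) 1,
      t ^ (b + n - 1) * (1 - t) ^ (s - 1) * F21 (e - c) (d - c) s (1 - t) =
      Gamma b * Gamma c * Gamma s / (Gamma d * Gamma e) *
        (poch b n * poch c n / (poch d n * poch e n)) := by
    intro n
    rw [(hM n).2, show b + n + s - (e - c) - (d - c) = c + n by rw [hs]; ring,
      show b + n + s - (e - c) = d + n by rw [hs]; ring,
      show b + n + s - (d - c) = e + n by rw [hs]; ring,
      Gamma_add_nat' hb, Gamma_add_nat' hc, Gamma_add_nat' hd, Gamma_add_nat' he]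
    have := (Gamma_pos_of_pos hd).ne'
    have := (Gamma_pos_of_pos he).ne'
    have := (poch_pos' hd n).ne'
    have := (poch_pos' he n).ne'
    field_simp
  set w : ℝ → ℝ := fun t => t ^ (b - 1) * (1 - t) ^ (s - 1) * F21 (e - c) (d - c) s (1 - t)
    with hw
  have hwi : IntegrableOn w (Set.Ioo 0 1) := by simpa [hw] using (hM 0).1
  have hrel : ∀ n : ℕ, ∀ t ∈ Set.Ioo (0 : ℝ) 1,
      t ^ (b + n - 1) * (1 - t) ^ (s - 1) * F21 (e - c) (d - c) s (1 - t) = t ^ n * w t := by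
    intro n t ht
    rw [show b + n - 1 = (b - 1) + n by ring, rpow_add ht.1, rpow_natCast]
    simp only [hw]
    ring
  set G : ℕ → ℝ → ℝ := fun n t => (poch a n / (n.factorial : ℝ) * x ^ n) *
    (t ^ (b + n - 1) * (1 - t) ^ (s - 1) * F21 (e - c) (d - c) s (1 - t)) with hG
  have hGi : ∀ n, Integrable (G n) (volume.restrict (Set.Ioo 0 1)) := fun n =>
    (hM n).1.const_mul _
  have hGs : Summable fun n => ∫ t in Set.Ioo (0 : ℝ) 1, ‖G n t‖ := by
    refine Summable.of_nonneg_of_le (fun n => integral_nonneg fun _ => norm_nonneg _) (fun n => ?_)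
      ((binom (a := a) hx).1.mul_right (∫ t in Set.Ioo (0 : ℝ) 1, ‖w t‖))
    rw [← integral_const_mul]
    refine setIntegral_mono_on (hGi n).norm (hwi.norm.const_mul _) measurableSet_Ioo ?_
    intro t ht
    simp only [hG]
    rw [hrel n t ht, norm_mul, Real.norm_eq_abs (_ * x ^ n)]
    refine mul_le_mul_of_nonneg_left ?_ (abs_nonneg _)
    rw [norm_mul]
    refine mul_le_of_le_one_left (norm_nonneg _) ?_
    rw [norm_pow, Real.norm_of_nonneg ht.1.le]
    exact pow_le_one₀ ht.1.le ht.2.le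
  have hcong : Set.EqOn (fun t => ∑' n, G n t)
      (fun t => t ^ (b - 1) * (1 - t) ^ (s - 1) * (1 - x * t) ^ (-a) *
            F21 (e - c) (d - c) s (1 - t)) (Set.Ioo 0 1) := by
    intro t ht
    have hxt : |x * t| < 1 := by
      rw [abs_mul, abs_of_pos ht.1]
      exact lt_of_le_of_lt (mul_le_of_le_one_right (abs_nonneg _) ht.2.le) hx
    have h := ((binom (a := a) hxt).2.mul_right (w t)).tsum_eq
    have h2 : ∀ n, G n t = poch a n / (n.factorial : ℝ) * (x * t) ^ n * w t := by
      intro n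
      simp only [hG]
      rw [hrel n t ht, mul_pow]
      ring
    simp only [h2]
    rw [h]
    simp only [hw]
    ring
  rw [← setIntegral_congr_fun measurableSet_Ioo hcong,
    ← integral_tsum_of_summable_integral_norm hGi hGs, F32, ← tsum_mul_left]
  refine tsum_congr (fun n => ?_)
  simp only [hG]
  rw [integral_const_mul, hval]
  have := (Gamma_pos_of_pos hb).ne'
  have := (Gamma_pos_of_pos hc).ne'
  have := (Gamma_pos_of_pos hbc).ne'
  have := (Gamma_pos_of_pos hd).ne'
  have := (Gamma_pos_of_pos he).ne'
  have := (poch_pos' hd n).ne'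
  have := (poch_pos' he n).ne'
  field_simp
end
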